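/- arXiv:0704.0679 — 5 statements merged into one kernel-verified Lean document; each statement's English description precedes it below -/
import Mathlib

section
/- Let κ = (κ₀,κ₁,κ₂,κ₃,κ₄) ∈ ℂ⁵ with 2κ₀+κ₁+κ₂+κ₃+κ₄ = 1 and assume κ₁ + κ₂ is not an integer. Then there exist r ∈ (0,1) and functions q, p : ℂ → ℂ, both analytic on the ball {z : |z| < r}, such that q(0) = 0, q′(0) = κ₁/(κ₁+κ₂), and (q,p) solves P_VI(κ) at every z with 0 < |z| < r. (Painlevé VI admits a holomorphic solution germ at the fixed singular point z = 0 with leading behavior q(z) = κ₁z/(κ₁+κ₂) + O(z²).) -/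
/-- The sixth Painlevé system `P_VI(κ)` holds for the pair `(q, p)` at the point `z`. -/
def SolvesPVIAt (κ₀ κ₁ κ₂ κ₃ κ₄ : ℂ) (q p : ℂ → ℂ) (z : ℂ) : Prop :=
  z * (z - 1) * deriv q z =
      2 * q z * (q z - 1) * (q z - z) * p z - κ₁ * (q z - 1) * (q z - z)
        - (κ₂ - 1) * q z * (q z - 1) - κ₃ * q z * (q z - z) ∧
  z * (z - 1) * deriv p z =
      -(3 * q z ^ 2 - 2 * (1 + z) * q z + z) * p z ^ 2
        + (κ₁ * (2 * q z - 1 - z) + (κ₂ - 1) * (2 * q z - 1) + κ₃ * (2 * q z - z)) * p z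
        - κ₀ * (κ₀ + κ₄)

/-- A causal operator on sequences has a fixed point. -/
lemma exists_fixedPoint_of_causal {E : Type*} [Inhabited E] (G : (ℕ → E) → ℕ → E)
    (hG : ∀ n f g, (∀ m < n, f m = g m) → G f n = G g n) : ∃ f : ℕ → E, ∀ n, f n = G f n := by
  classical
  let Φ : ∀ n : ℕ, (∀ m, m < n → E) → E :=
    fun n F => G (fun m => if h : m < n then F m h else default) n
  refine ⟨Nat.lt_wfRel.wf.fix Φ, fun n => ?_⟩
  rw [WellFounded.fix_eq]
  refine hG n _ _ fun m hm => ?_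
  exact dif_pos hm

/-- Powers of `X` dividing the differences of the arguments divide the difference of the values
of a polynomial. -/
lemma PowerSeries.X_pow_dvd_aeval_sub_aeval {σ : Type*} (P : MvPolynomial σ ℂ)
    (f g : σ → PowerSeries ℂ) (n : ℕ)
    (h : ∀ s, (PowerSeries.X : PowerSeries ℂ) ^ n ∣ f s - g s) :
    (PowerSeries.X : PowerSeries ℂ) ^ n ∣ MvPolynomial.aeval f P - MvPolynomial.aeval g P := by
  induction P using MvPolynomial.induction_on with
  | C c => simp
  | add p q hp hq =>
    rw [map_add, map_add, add_sub_add_comm]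
    exact dvd_add hp hq
  | mul_X p s hp =>
    rw [map_mul, map_mul, MvPolynomial.aeval_X, MvPolynomial.aeval_X,
      show ∀ a b c d : PowerSeries ℂ, a * b - c * d = (a - c) * b + c * (b - d) by intros; ring]
    exact dvd_add (hp.mul_right _) ((h s).mul_left _)

/-- The formal Briot–Bouquet system with diagonal nonresonant linear part is solvable. -/
lemma exists_formal_briotBouquet {ι : Type*} (a b : ι → ℂ) (ha : ∀ i (n : ℕ), a i ≠ n)
    (P : ι → MvPolynomial (Option ι) ℂ) :
    ∃ y : ι → PowerSeries ℂ, ∀ i, (0 - a i) * (y i).coeff 0 = b i ∧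
      ∀ n : ℕ, ((n + 1 : ℕ) - a i) * (y i).coeff (n + 1) = n * (y i).coeff n +
        (MvPolynomial.aeval (fun o : Option ι => o.elim PowerSeries.X y) (P i)).coeff n := by
  let Y : (ℕ → ι → ℂ) → ι → PowerSeries ℂ := fun f i => PowerSeries.mk fun n => f n i
  let G : (ℕ → ι → ℂ) → ℕ → ι → ℂ := fun f n i => match n with
    | 0 => -b i / a i
    | n + 1 => (n * f n i + (MvPolynomial.aeval
        (fun o : Option ι => o.elim PowerSeries.X (Y f)) (P i)).coeff n) / ((n + 1 : ℕ) - a i)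
  obtain ⟨f, hf⟩ := exists_fixedPoint_of_causal G (by
    rintro (_ | n) f g hfg
    · rfl
    · funext i
      have hdvd := PowerSeries.X_pow_dvd_aeval_sub_aeval (P i)
        (fun o : Option ι => o.elim PowerSeries.X (Y f))
        (fun o : Option ι => o.elim PowerSeries.X (Y g)) (n + 1) (by
          rintro (_ | j)
          · simp
          · rw [PowerSeries.X_pow_dvd_iff]
            intro m hm
            simp [Y, hfg m hm])
      have hn := PowerSeries.X_pow_dvd_iff.1 hdvd n n.lt_succ_self
      rw [map_sub, sub_eq_zero] at hn
      simp only [G, hn, hfg n n.lt_succ_self])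
  refine ⟨Y f, fun i => ⟨?_, fun n => ?_⟩⟩
  · have h0 : a i ≠ 0 := by simpa using ha i 0
    have := congrFun (hf 0) i
    simp only [Y, PowerSeries.coeff_mk, this, G]
    field_simp
    ring
  · have h0 : ((n + 1 : ℕ) : ℂ) - a i ≠ 0 := sub_ne_zero.2 (ha i (n + 1)).symm
    have := congrFun (hf (n + 1)) i
    rw [show (Y f i).coeff (n + 1) = f (n + 1) i by simp [Y], this]
    simp only [G]
    rw [mul_div_cancel₀ _ h0]
    simp [Y]

/-- Partial sums of the weighted `ℓ¹` norm of a power series. -/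
noncomputable def PowerSeries.partialNorm (r : ℝ) (N : ℕ) (f : PowerSeries ℂ) : ℝ :=
  ∑ n ∈ Finset.range N, ‖f.coeff n‖ * r ^ n

namespace PowerSeries

lemma partialNorm_nonneg {r : ℝ} (hr : 0 ≤ r) (N : ℕ) (f : PowerSeries ℂ) :
    0 ≤ partialNorm r N f :=
  Finset.sum_nonneg fun _ _ => by positivity

lemma partialNorm_add_le {r : ℝ} (hr : 0 ≤ r) (N : ℕ) (f g : PowerSeries ℂ) :
    partialNorm r N (f + g) ≤ partialNorm r N f + partialNorm r N g := by
  simp only [partialNorm, ← Finset.sum_add_distrib, ← add_mul, map_add]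
  gcongr
  exact norm_add_le _ _

lemma partialNorm_mul_le {r : ℝ} (hr : 0 ≤ r) (N : ℕ) (f g : PowerSeries ℂ) :
    partialNorm r N (f * g) ≤ partialNorm r N f * partialNorm r N g := by
  let F : ℕ × ℕ → ℝ := fun x => (‖f.coeff x.1‖ * r ^ x.1) * (‖g.coeff x.2‖ * r ^ x.2)
  have h1 : partialNorm r N (f * g) ≤
      ∑ n ∈ Finset.range N, ∑ x ∈ Finset.HasAntidiagonal.antidiagonal n, F x := by
    refine Finset.sum_le_sum fun n _ => ?_
    rw [coeff_mul]
    calc _ ≤ (∑ x ∈ Finset.HasAntidiagonal.antidiagonal n, ‖f.coeff x.1 * g.coeff x.2‖) * r ^ n := by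
          gcongr
          exact norm_sum_le _ _
      _ = _ := by
          rw [Finset.sum_mul]
          refine Finset.sum_congr rfl fun x hx => ?_
          rw [← Finset.HasAntidiagonal.mem_antidiagonal.1 hx, norm_mul, pow_add]
          ring
  refine h1.trans ?_
  rw [← Finset.sum_biUnion, partialNorm, partialNorm, Finset.sum_mul_sum, ← Finset.sum_product']
  · refine Finset.sum_le_sum_of_subset_of_nonneg (fun x hx => ?_) fun x _ _ => by positivity
    simp only [Finset.mem_biUnion, Finset.mem_range, Finset.HasAntidiagonal.mem_antidiagonal] at hx
    simp only [Finset.mem_product, Finset.mem_range]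
    omega
  · intro m _ n _ hmn
    refine Finset.disjoint_left.2 fun x hx hx' => hmn ?_
    rw [← Finset.HasAntidiagonal.mem_antidiagonal.1 hx, ← Finset.HasAntidiagonal.mem_antidiagonal.1 hx']

lemma partialNorm_C_le {r : ℝ} (N : ℕ) (c : ℂ) :
    partialNorm r N (C c) ≤ ‖c‖ := by
  rcases N with _ | N
  · simp [partialNorm]
  · simp [partialNorm, Finset.sum_range_succ', coeff_C]

lemma partialNorm_X_le {r : ℝ} (hr : 0 ≤ r) (N : ℕ) :
    partialNorm r N X ≤ r := by
  rcases N with _ | _ | N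
  · simpa [partialNorm]
  · simpa [partialNorm]
  · simp [partialNorm, Finset.sum_range_succ', coeff_X]

/-- A polynomial maps bounded families of power series to bounded ones, uniformly in the
radius and in the truncation order. -/
lemma exists_partialNorm_aeval_le {σ : Type*} (P : MvPolynomial σ ℂ) (M : ℝ) (hM : 0 ≤ M) :
    ∃ B, 0 ≤ B ∧ ∀ (r : ℝ) (N : ℕ) (f : σ → PowerSeries ℂ), 0 ≤ r →
      (∀ s, partialNorm r N (f s) ≤ M) → partialNorm r N (MvPolynomial.aeval f P) ≤ B := by
  induction P using MvPolynomial.induction_on with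
  | C c =>
    refine ⟨‖c‖, norm_nonneg _, fun r N f _ _ => ?_⟩
    rw [MvPolynomial.aeval_C]
    exact partialNorm_C_le N c
  | add p q hp hq =>
    obtain ⟨B, hB, h⟩ := hp
    obtain ⟨B', hB', h'⟩ := hq
    refine ⟨B + B', add_nonneg hB hB', fun r N f hr hf => ?_⟩
    rw [map_add]
    exact (partialNorm_add_le hr N _ _).trans (add_le_add (h r N f hr hf) (h' r N f hr hf))
  | mul_X p s hp =>
    obtain ⟨B, hB, h⟩ := hp
    refine ⟨B * M, mul_nonneg hB hM, fun r N f hr hf => ?_⟩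
    rw [map_mul, MvPolynomial.aeval_X]
    exact (partialNorm_mul_le hr N _ _).trans
      (mul_le_mul (h r N f hr hf) (hf s) (partialNorm_nonneg hr N _) hB)

end PowerSeries

/-- Small divisors are absent: `n + 1` is controlled by `n + 1 - a` off resonance. -/
lemma exists_natCast_le_mul_norm_sub (a : ℂ) (ha : ∀ n : ℕ, a ≠ n) :
    ∃ K : ℝ, 0 ≤ K ∧ ∀ n : ℕ, (n + 1 : ℝ) ≤ K * ‖((n + 1 : ℕ) : ℂ) - a‖ := by
  have hO : (fun n : ℕ => (n + 1 : ℝ)) =O[Filter.atTop] fun n : ℕ => ((n + 1 : ℕ) : ℂ) - a := by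
    refine Asymptotics.IsBigO.of_bound 2 ?_
    obtain ⟨m, hm⟩ := exists_nat_ge (2 * ‖a‖)
    filter_upwards [Filter.eventually_ge_atTop m] with n hn
    have h1 : ‖((n + 1 : ℕ) : ℂ)‖ - ‖a‖ ≤ ‖((n + 1 : ℕ) : ℂ) - a‖ := norm_sub_norm_le _ _
    rw [Complex.norm_natCast] at h1
    have h2 : (m : ℝ) ≤ n := by exact_mod_cast hn
    push_cast at h1 ⊢
    rw [Real.norm_of_nonneg (by positivity)]
    linarith
  obtain ⟨K, hK, h⟩ := Asymptotics.bound_of_isBigO_nat_atTop hO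
  refine ⟨K, hK.le, fun n => ?_⟩
  have := h (x := n) (sub_ne_zero.2 (ha (n + 1)).symm)
  rwa [Real.norm_of_nonneg (by positivity)] at this

/-- Formal solutions of a nonresonant diagonal Briot–Bouquet system converge. -/
lemma exists_summable_of_formal_briotBouquet {ι : Type*} [Finite ι] (a : ι → ℂ)
    (ha : ∀ i (n : ℕ), a i ≠ n) (P : ι → MvPolynomial (Option ι) ℂ) (y : ι → PowerSeries ℂ)
    (hy : ∀ i (n : ℕ), ((n + 1 : ℕ) - a i) * (y i).coeff (n + 1) = n * (y i).coeff n +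
        (MvPolynomial.aeval (fun o : Option ι => o.elim PowerSeries.X y) (P i)).coeff n) :
    ∃ r : ℝ, 0 < r ∧ ∀ i, Summable fun n => ‖(y i).coeff n‖ * r ^ n := by
  cases nonempty_fintype ι
  choose K hK0 hK using fun i => exists_natCast_le_mul_norm_sub (a i) (ha i)
  obtain ⟨M, hM⟩ := (Set.finite_range fun i => ‖(y i).coeff 0‖).bddAbove
  have hM i : ‖(y i).coeff 0‖ ≤ M := hM ⟨i, rfl⟩
  set M' := max M 0 + 1
  have hM' : 1 ≤ M' := by simp [M']
  choose B hB0 hB using fun i => PowerSeries.exists_partialNorm_aeval_le (P i) M' (by linarith)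
  have hD0 : 0 ≤ ∑ i, K i * (M' + B i) :=
    Finset.sum_nonneg fun i _ => mul_nonneg (hK0 i) (by linarith [hB0 i])
  set D := ∑ i, K i * (M' + B i) with hD
  set r : ℝ := 1 / (D + 1)
  have hr : 0 < r := by positivity
  have hr1 : r ≤ 1 := by
    rw [div_le_one (by linarith)]
    linarith
  have hrD : r * D ≤ 1 := by
    rw [one_div_mul_eq_div, div_le_one (by linarith)]
    linarith
  have key : ∀ N i, PowerSeries.partialNorm r N (y i) ≤ M' := by
    intro N
    induction N with
    | zero =>
      intro i
      simp only [PowerSeries.partialNorm, Finset.range_zero, Finset.sum_empty]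
      linarith
    | succ N ih =>
      intro i
      set Q := MvPolynomial.aeval (fun o : Option ι => o.elim PowerSeries.X y) (P i) with hQ
      have hQB : PowerSeries.partialNorm r N Q ≤ B i := by
        refine hB i r N _ hr.le ?_
        rintro (_ | j)
        · exact (PowerSeries.partialNorm_X_le hr.le N).trans (hr1.trans hM')
        · exact ih j
      have hstep (n : ℕ) : ‖(y i).coeff (n + 1)‖ ≤ K i * (‖(y i).coeff n‖ + ‖Q.coeff n‖) := by
        have h1 : (n + 1 : ℝ) * ‖(y i).coeff (n + 1)‖ ≤
            K i * ((n + 1) * (‖(y i).coeff n‖ + ‖Q.coeff n‖)) := by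
          calc _ ≤ K i * ‖((n + 1 : ℕ) : ℂ) - a i‖ * ‖(y i).coeff (n + 1)‖ := by
                gcongr
                exact hK i n
            _ = K i * ‖n * (y i).coeff n + Q.coeff n‖ := by
                rw [mul_assoc, ← norm_mul, hy i n]
            _ ≤ _ := by
                refine mul_le_mul_of_nonneg_left ((norm_add_le _ _).trans ?_) (hK0 i)
                rw [norm_mul, Complex.norm_natCast]
                nlinarith [norm_nonneg ((y i).coeff n), norm_nonneg (Q.coeff n),
                  mul_nonneg (Nat.cast_nonneg (α := ℝ) n) (norm_nonneg (Q.coeff n))]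
        have hn : (0 : ℝ) < n + 1 := by positivity
        refine le_of_mul_le_mul_left (h1.trans (le_of_eq ?_)) hn
        ring
      have hsum : PowerSeries.partialNorm r (N + 1) (y i) ≤ ‖(y i).coeff 0‖ +
          r * (K i * (PowerSeries.partialNorm r N (y i) + PowerSeries.partialNorm r N Q)) := by
        simp only [PowerSeries.partialNorm, Finset.sum_range_succ', pow_zero, mul_one]
        rw [add_comm]
        refine add_le_add_right ?_ _
        rw [← Finset.sum_add_distrib, Finset.mul_sum, Finset.mul_sum]
        refine Finset.sum_le_sum fun n _ => ?_
        calc _ ≤ K i * (‖(y i).coeff n‖ + ‖Q.coeff n‖) * r ^ (n + 1) := by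
              gcongr
              exact hstep n
          _ = _ := by ring
      have hKD : K i * (M' + B i) ≤ D :=
        Finset.single_le_sum (f := fun i => K i * (M' + B i))
          (fun j _ => mul_nonneg (hK0 j) (by linarith [hB0 j])) (Finset.mem_univ i)
      calc _ ≤ _ := hsum
        _ ≤ ‖(y i).coeff 0‖ + r * (K i * (M' + B i)) := by
            gcongr
            · exact hK0 i
            · exact ih i
        _ ≤ M + r * D := by
            gcongr
            exact hM i
        _ ≤ M' := by
            have := le_max_left M 0
            simp only [M']
            linarith
  exact ⟨r, hr, fun i => summable_of_sum_range_le (fun n => by positivity) fun N => key N i⟩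

lemma HasSum.of_forall_eq {β : Type*} {f g : β → ℂ} {v : ℂ} (hf : HasSum f v)
    (h : ∀ n, g n = f n) : HasSum g v := by
  rwa [funext h]

/-- Evaluation of convergent power series commutes with polynomial operations. -/
lemma PowerSeries.hasSum_coeff_mvPolynomial_aeval {σ : Type*} (P : MvPolynomial σ ℂ) (z : ℂ)
    (f : σ → PowerSeries ℂ) (v : σ → ℂ)
    (h : ∀ s, HasSum (fun n => (f s).coeff n * z ^ n) (v s)) :
    HasSum (fun n => (MvPolynomial.aeval f P).coeff n * z ^ n) (MvPolynomial.eval v P) := by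
  induction P using MvPolynomial.induction_on with
  | C c =>
    rw [MvPolynomial.aeval_C, MvPolynomial.eval_C]
    have := hasSum_single (f := fun n => (PowerSeries.C c).coeff n * z ^ n) 0
      (fun n hn => by simp [PowerSeries.coeff_C, hn])
    simpa using this
  | add p q hp hq =>
    rw [map_add, map_add]
    simpa only [map_add, add_mul] using hp.add hq
  | mul_X p s hp =>
    rw [map_mul, map_mul, MvPolynomial.aeval_X, MvPolynomial.eval_X]
    have hp' := hp.summable.norm
    have hs' := (h s).summable.norm
    have hsum := (summable_norm_sum_mul_antidiagonal_of_summable_norm hp' hs').of_norm.hasSum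
    rw [← tsum_mul_tsum_eq_tsum_sum_antidiagonal_of_summable_norm hp' hs', hp.tsum_eq,
      (h s).tsum_eq] at hsum
    refine HasSum.of_forall_eq hsum fun n => ?_
    rw [PowerSeries.coeff_mul, Finset.sum_mul]
    refine Finset.sum_congr rfl fun x hx => ?_
    rw [← Finset.HasAntidiagonal.mem_antidiagonal.1 hx, pow_add]
    ring

/-- **Briot–Bouquet theorem** for systems with polynomial nonlinearity and diagonal nonresonant
linear part, in the form `z (1 - z) dy/dz = a y + b + z P(z, y)`. -/
theorem exists_holomorphic_briotBouquet {ι : Type*} [Finite ι] (a b : ι → ℂ)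
    (ha : ∀ i (n : ℕ), a i ≠ n) (P : ι → MvPolynomial (Option ι) ℂ) :
    ∃ r : ℝ, 0 < r ∧ ∃ y : ι → ℂ → ℂ,
      (∀ i, DifferentiableOn ℂ (y i) (Metric.ball 0 r)) ∧
      ∀ i, ∀ z ∈ Metric.ball (0 : ℂ) r, z * (1 - z) * deriv (y i) z = a i * y i z + b i +
        z * MvPolynomial.eval (fun o : Option ι => o.elim z fun j => y j z) (P i) := by
  obtain ⟨f, hf⟩ := exists_formal_briotBouquet a b ha P
  obtain ⟨r, hr, hsum⟩ := exists_summable_of_formal_briotBouquet a ha P f fun i => (hf i).2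
  have hdiff i n : DifferentiableOn ℂ (fun z : ℂ => (f i).coeff n * z ^ n) (Metric.ball 0 r) := by
    fun_prop
  have hle i n (z : ℂ) (hz : z ∈ Metric.ball (0 : ℂ) r) :
      ‖(f i).coeff n * z ^ n‖ ≤ ‖(f i).coeff n‖ * r ^ n := by
    rw [norm_mul, norm_pow]
    have := (mem_ball_zero_iff.1 hz).le
    gcongr
  refine ⟨r, hr, fun i z => ∑' n, (f i).coeff n * z ^ n, fun i =>
    Complex.differentiableOn_tsum_of_summable_norm (hsum i) (hdiff i) Metric.isOpen_ball (hle i),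
    fun i z hz => ?_⟩
  have hval j : HasSum (fun n => (f j).coeff n * z ^ n) (∑' n, (f j).coeff n * z ^ n) :=
    (Summable.of_norm_bounded (hsum j) fun n => hle j n z hz).hasSum
  have hP := PowerSeries.hasSum_coeff_mvPolynomial_aeval (P i) z (fun o : Option ι => o.elim PowerSeries.X f)
    (fun o => o.elim z fun j => ∑' n, (f j).coeff n * z ^ n) (by
      rintro (_ | j)
      · have := hasSum_single (f := fun n => (PowerSeries.X : PowerSeries ℂ).coeff n * z ^ n) 1
          (fun n hn => by simp [PowerSeries.coeff_X, hn])
        simpa using this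
      · exact hval j)
  have hder : HasSum (fun n : ℕ => n * (f i).coeff n * z ^ n)
      (z * deriv (fun w => ∑' n, (f i).coeff n * w ^ n) z) := by
    have := (Complex.hasSum_deriv_of_summable_norm (hsum i) (hdiff i) Metric.isOpen_ball (hle i)
      hz).mul_left z
    refine HasSum.of_forall_eq this fun n => ?_
    rcases n with _ | n
    · simp
    · simp
      ring
  have hlhs := (hder.sub ((hval i).mul_left (a i)))
  have hrhs := ((hder.add hP).mul_left z)
  have hshift := (hasSum_nat_add_iff' 1).2 hlhs
  have hcongr : (fun n : ℕ => ((n + 1 : ℕ) : ℂ) * (f i).coeff (n + 1) * z ^ (n + 1) -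
      a i * ((f i).coeff (n + 1) * z ^ (n + 1))) = fun n : ℕ => z * (n * (f i).coeff n * z ^ n +
      (MvPolynomial.aeval (fun o : Option ι => o.elim PowerSeries.X f) (P i)).coeff n * z ^ n) := by
    funext n
    have := (hf i).2 n
    linear_combination z ^ (n + 1) * this
  rw [hcongr] at hshift
  have heq := hshift.unique hrhs
  have h0 := (hf i).1
  simp only [Finset.sum_range_one, Nat.cast_zero, pow_zero] at heq
  linear_combination heq + h0

/-- If `κ₁ + κ₂ ∉ ℤ`, Painlevé VI admits a holomorphic solution germ at `z = 0` with
`q(z) = κ₁ z/(κ₁+κ₂) + O(z²)`. -/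
theorem holomorphic_solution_germ_k1_plus_k2
    (κ₀ κ₁ κ₂ κ₃ κ₄ : ℂ) (hκ : 2 * κ₀ + κ₁ + κ₂ + κ₃ + κ₄ = 1)
    (h : ∀ m : ℤ, κ₁ + κ₂ ≠ (m : ℂ)) :
    ∃ (r : ℝ) (q p : ℂ → ℂ), 0 < r ∧ r < 1 ∧
      (∀ z ∈ Metric.ball (0 : ℂ) r, AnalyticAt ℂ q z) ∧
      (∀ z ∈ Metric.ball (0 : ℂ) r, AnalyticAt ℂ p z) ∧
      q 0 = 0 ∧ deriv q 0 = κ₁ / (κ₁ + κ₂) ∧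
      ∀ z ∈ Metric.ball (0 : ℂ) r, z ≠ 0 → SolvesPVIAt κ₀ κ₁ κ₂ κ₃ κ₄ q p z := by
  let Z : MvPolynomial (Option (Fin 2)) ℂ := .X none
  let U : MvPolynomial (Option (Fin 2)) ℂ := .X (some 0)
  let V : MvPolynomial (Option (Fin 2)) ℂ := .X (some 1)
  obtain ⟨R, hR, y, hy, hode⟩ := exists_holomorphic_briotBouquet
    ![-(κ₁ + κ₂), κ₁ + κ₂ - 1] ![κ₁, κ₀ * (κ₀ + κ₄)] (by
      intro i n
      fin_cases i
      · intro h'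
        refine h (-n) ?_
        simp at h' ⊢
        linear_combination -h'
      · intro h'
        refine h (n + 1) ?_
        simp at h' ⊢
        linear_combination h')
    ![U - 2 * U * (U - 1) * (Z * U - 1) * V + .C (κ₁ + κ₃) * U * (U - 1) + .C (κ₂ - 1) * U ^ 2,
      (3 * Z * U ^ 2 - 2 * (1 + Z) * U + 1) * V ^ 2 -
        (.C κ₁ * (2 * U - 1) + .C (κ₂ - 1) * (2 * U) + .C κ₃ * (2 * U - 1)) * V]
  have hu := hode 0
  have hp := hode 1
  simp only [Matrix.cons_val_zero, Matrix.cons_val_one, Z, U, V, map_add, map_sub, map_mul,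
    map_pow, map_one, map_ofNat, MvPolynomial.eval_X, MvPolynomial.eval_C, Option.elim] at hu hp
  have hsub : Metric.ball (0 : ℂ) (min R (1 / 2)) ⊆ Metric.ball 0 R :=
    Metric.ball_subset_ball (min_le_left _ _)
  have han i (z : ℂ) (hz : z ∈ Metric.ball 0 R) : AnalyticAt ℂ (y i) z :=
    (hy i).analyticAt (Metric.isOpen_ball.mem_nhds hz)
  have hq (z : ℂ) (hz : z ∈ Metric.ball 0 R) :
      deriv (fun w => w * y 0 w) z = y 0 z + z * deriv (y 0) z := by
    have := (hasDerivAt_id' z).fun_mul (han 0 z hz).differentiableAt.hasDerivAt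
    simpa using this.deriv
  have h0 : (0 : ℂ) ∈ Metric.ball 0 R := Metric.mem_ball_self hR
  refine ⟨min R (1 / 2), fun z => z * y 0 z, y 1, by positivity,
    (min_le_right _ _).trans_lt (by norm_num), fun z hz => analyticAt_id.mul (han 0 z (hsub hz)),
    fun z hz => han 1 z (hsub hz), by simp, ?_, fun z hz _ => ⟨?_, ?_⟩⟩
  · have hs : κ₁ + κ₂ ≠ 0 := by simpa using h 0
    rw [hq 0 h0, eq_div_iff hs]
    linear_combination hu 0 h0
  · rw [hq z (hsub hz)]
    linear_combination -z * hu z (hsub hz)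
  · linear_combination -hp z (hsub hz)
end

section
/- Let κ = (κ₀,κ₁,κ₂,κ₃,κ₄) ∈ ℂ⁵ with 2κ₀+κ₁+κ₂+κ₃+κ₄ = 1 and assume κ₁ − κ₂ is not an integer. Then there exist r ∈ (0,1) and functions q, p₀ : ℂ → ℂ, both analytic on the ball {z : |z| < r}, such that q(0) = 0, q′(0) = κ₁/(κ₁−κ₂), and the pair (q, p) with p(z) = (κ₁−κ₂)/z + p₀(z) solves P_VI(κ) at every z with 0 < |z| < r. (Painlevé VI admits a meromorphic solution germ at z = 0 with q(z) = κ₁z/(κ₁−κ₂) + O(z²) and p having a simple pole at z = 0 with residue κ₁−κ₂.) -/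
namespace MeromorphicGerm

open PowerSeries Filter Topology

/-- The weighted `ℓ¹` norm of the coefficients of `f`, with weights `r ^ n`, is at most `C`. -/
def WeightedNormLE (r : ℝ) (f : ℂ⟦X⟧) (C : ℝ) : Prop :=
  Summable (fun n => ‖coeff n f‖ * r ^ n) ∧ ∑' n, ‖coeff n f‖ * r ^ n ≤ C

/-- The power series `f` converges at `z` with sum `s`. -/
def SumsTo (f : ℂ⟦X⟧) (z s : ℂ) : Prop :=
  HasSum (fun n => coeff n f * z ^ n) s

namespace WeightedNormLE

variable {r C D : ℝ} {f g : ℂ⟦X⟧}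

lemma nonneg (hr : 0 ≤ r) (hf : WeightedNormLE r f C) : 0 ≤ C :=
  (tsum_nonneg fun n => by positivity).trans hf.2

lemma mono (hf : WeightedNormLE r f C) (h : C ≤ D) : WeightedNormLE r f D :=
  ⟨hf.1, hf.2.trans h⟩

lemma of_le {b : ℕ → ℝ} (hr : 0 ≤ r) (hb : Summable b) (hC : ∑' n, b n ≤ C)
    (h : ∀ n, ‖coeff n f‖ * r ^ n ≤ b n) : WeightedNormLE r f C := by
  have hs : Summable (fun n => ‖coeff n f‖ * r ^ n) :=
    Summable.of_nonneg_of_le (fun n => by positivity) h hb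
  exact ⟨hs, (hs.tsum_le_tsum h hb).trans hC⟩

lemma add (hr : 0 ≤ r) (hf : WeightedNormLE r f C) (hg : WeightedNormLE r g D) :
    WeightedNormLE r (f + g) (C + D) := by
  refine of_le hr (hf.1.add hg.1) ?_ fun n => ?_
  · rw [hf.1.tsum_add hg.1]
    exact add_le_add hf.2 hg.2
  · rw [map_add, ← add_mul]
    gcongr
    exact norm_add_le _ _

lemma mul (hr : 0 ≤ r) (hf : WeightedNormLE r f C) (hg : WeightedNormLE r g D) :
    WeightedNormLE r (f * g) (C * D) := by
  have hf' : Summable fun n => ‖‖coeff n f‖ * r ^ n‖ := hf.1.norm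
  have hg' : Summable fun n => ‖‖coeff n g‖ * r ^ n‖ := hg.1.norm
  refine of_le hr
    (summable_norm_sum_mul_antidiagonal_of_summable_norm hf' hg').of_norm ?_ fun n => ?_
  · rw [← tsum_mul_tsum_eq_tsum_sum_antidiagonal_of_summable_norm hf' hg']
    exact mul_le_mul hf.2 hg.2 (tsum_nonneg fun n => by positivity) (hf.nonneg hr)
  · rw [coeff_mul]
    calc ‖∑ p ∈ Finset.HasAntidiagonal.antidiagonal n, coeff p.1 f * coeff p.2 g‖ * r ^ n
        ≤ (∑ p ∈ Finset.HasAntidiagonal.antidiagonal n, ‖coeff p.1 f * coeff p.2 g‖) * r ^ n := by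
          gcongr
          exact norm_sum_le _ _
      _ = _ := by
          rw [Finset.sum_mul]
          refine Finset.sum_congr rfl fun p hp => ?_
          rw [← Finset.HasAntidiagonal.mem_antidiagonal.1 hp, norm_mul, pow_add]
          ring

lemma monomial (m : ℕ) (c : ℂ) : WeightedNormLE r (PowerSeries.monomial m c) (‖c‖ * r ^ m) := by
  have h : HasSum (fun n => ‖coeff n (PowerSeries.monomial m c)‖ * r ^ n) (‖c‖ * r ^ m) := by
    convert hasSum_single (f := fun n => ‖coeff n (PowerSeries.monomial m c)‖ * r ^ n) m ?_ using 1
    · simp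
    · intro n hn
      simp [coeff_monomial, hn]
  exact ⟨h.summable, h.tsum_eq.le⟩

lemma const (c : ℂ) : WeightedNormLE r (PowerSeries.C c) ‖c‖ := by
  simpa using monomial (r := r) 0 c

lemma X : WeightedNormLE r (PowerSeries.X : ℂ⟦X⟧) r := by
  simpa [X_eq] using monomial (r := r) 1 1

lemma pow (hr : 0 ≤ r) (hf : WeightedNormLE r f C) (n : ℕ) :
    WeightedNormLE r (f ^ n) (C ^ n) := by
  induction n with
  | zero => simpa using const (r := r) 1
  | succ n ih => simpa only [pow_succ] using ih.mul hr hf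

lemma geometric (hr : 0 ≤ r) (hr' : r ≤ 1 / 2) :
    WeightedNormLE r (PowerSeries.mk fun _ => (1 : ℂ)) 2 := by
  have h := hasSum_geometric_of_lt_one hr (by linarith)
  refine of_le hr h.summable ?_ fun n => by simp
  rw [h.tsum_eq, inv_le_comm₀ (by linarith) two_pos]
  linarith

end WeightedNormLE

namespace SumsTo

variable {f g : ℂ⟦X⟧} {z s t : ℂ}

lemma add (hf : SumsTo f z s) (hg : SumsTo g z t) : SumsTo (f + g) z (s + t) := by
  simpa [SumsTo, add_mul] using HasSum.add hf hg

lemma mul (hf : SumsTo f z s) (hg : SumsTo g z t) : SumsTo (f * g) z (s * t) := by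
  have hf' := hf.summable.norm
  have hg' := hg.summable.norm
  have h := (summable_norm_sum_mul_antidiagonal_of_summable_norm hf' hg').of_norm.hasSum
  rw [← tsum_mul_tsum_eq_tsum_sum_antidiagonal_of_summable_norm hf' hg',
    hf.tsum_eq, hg.tsum_eq] at h
  refine h.congr_fun fun n => ?_
  rw [coeff_mul, Finset.sum_mul]
  refine Finset.sum_congr rfl fun p hp => ?_
  rw [← Finset.HasAntidiagonal.mem_antidiagonal.1 hp, pow_add]
  ring

lemma monomial (m : ℕ) (c : ℂ) : SumsTo (PowerSeries.monomial m c) z (c * z ^ m) := by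
  unfold SumsTo
  convert hasSum_single (f := fun n => coeff n (PowerSeries.monomial m c) * z ^ n) m ?_ using 1
  · simp
  · intro n hn
    simp [coeff_monomial, hn]

lemma const (c : ℂ) : SumsTo (PowerSeries.C c) z c := by
  simpa using monomial (z := z) 0 c

lemma X : SumsTo (PowerSeries.X : ℂ⟦X⟧) z z := by
  simpa [X_eq] using monomial (z := z) 1 1

lemma pow (hf : SumsTo f z s) (n : ℕ) : SumsTo (f ^ n) z (s ^ n) := by
  induction n with
  | zero => simpa using const (z := z) 1
  | succ n ih => simpa only [pow_succ] using ih.mul hf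

lemma geometric (hz : ‖z‖ < 1) : SumsTo (PowerSeries.mk fun _ => (1 : ℂ)) z (1 - z)⁻¹ := by
  simpa [SumsTo] using hasSum_geometric_of_norm_lt_one hz

end SumsTo

/-- The map `F` on pairs of power series realizes the function `φ` of `(z, x, y)`, is contracting
for the `X`-adic topology, and is bounded independently of its arguments on weighted `ℓ¹` balls
as soon as the weight is small enough. -/
structure ContractingRealization (φ : ℂ → ℂ → ℂ → ℂ) (F : ℂ⟦X⟧ → ℂ⟦X⟧ → ℂ⟦X⟧) : Prop where
  dvd : ∀ (k : ℕ) (U U' V V' : ℂ⟦X⟧), X ^ k ∣ U - U' → X ^ k ∣ V - V' →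
    X ^ (k + 1) ∣ F U V - F U' V'
  bound : ∃ C, 0 ≤ C ∧ ∀ ρ, ∀ᶠ r in 𝓝[>] (0 : ℝ), ∀ U V, WeightedNormLE r U ρ →
    WeightedNormLE r V ρ → WeightedNormLE r (F U V) C
  sumsTo : ∀ (z x y : ℂ) (U V : ℂ⟦X⟧), ‖z‖ < 1 → SumsTo U z x → SumsTo V z y →
    SumsTo (F U V) z (φ z x y)

/-- The function `φ` of `(z, x, y)` has a contracting realization on power series. -/
def IsContracting (φ : ℂ → ℂ → ℂ → ℂ) : Prop := ∃ F, ContractingRealization φ F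

namespace IsContracting

variable {φ ψ : ℂ → ℂ → ℂ → ℂ}

lemma add (hφ : IsContracting φ) (hψ : IsContracting ψ) :
    IsContracting (fun z x y => φ z x y + ψ z x y) := by
  obtain ⟨F, hF⟩ := hφ
  obtain ⟨G, hG⟩ := hψ
  refine ⟨fun U V => F U V + G U V, ⟨fun k U U' V V' hU hV => ?_, ?_, ?_⟩⟩
  · rw [add_sub_add_comm]
    exact dvd_add (hF.dvd k U U' V V' hU hV) (hG.dvd k U U' V V' hU hV)
  · obtain ⟨C, hC, hFC⟩ := hF.bound
    obtain ⟨D, hD, hGD⟩ := hG.bound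
    refine ⟨C + D, by positivity, fun ρ => ?_⟩
    filter_upwards [hFC ρ, hGD ρ, self_mem_nhdsWithin] with r h₁ h₂ hr U V hU hV
    exact (h₁ U V hU hV).add (le_of_lt hr) (h₂ U V hU hV)
  · exact fun z x y U V hz hU hV => (hF.sumsTo z x y U V hz hU hV).add (hG.sumsTo z x y U V hz hU hV)

lemma mul (hφ : IsContracting φ) (hψ : IsContracting ψ) :
    IsContracting (fun z x y => φ z x y * ψ z x y) := by
  obtain ⟨F, hF⟩ := hφ
  obtain ⟨G, hG⟩ := hψ
  refine ⟨fun U V => F U V * G U V, ⟨fun k U U' V V' hU hV => ?_, ?_, ?_⟩⟩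
  · have : F U V * G U V - F U' V' * G U' V' =
        F U V * (G U V - G U' V') + (F U V - F U' V') * G U' V' := by ring
    rw [this]
    exact dvd_add ((hG.dvd k U U' V V' hU hV).mul_left _) ((hF.dvd k U U' V V' hU hV).mul_right _)
  · obtain ⟨C, hC, hFC⟩ := hF.bound
    obtain ⟨D, hD, hGD⟩ := hG.bound
    refine ⟨C * D, by positivity, fun ρ => ?_⟩
    filter_upwards [hFC ρ, hGD ρ, self_mem_nhdsWithin] with r h₁ h₂ hr U V hU hV
    exact (h₁ U V hU hV).mul (le_of_lt hr) (h₂ U V hU hV)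
  · exact fun z x y U V hz hU hV => (hF.sumsTo z x y U V hz hU hV).mul (hG.sumsTo z x y U V hz hU hV)

lemma const (c : ℂ) : IsContracting (fun _ _ _ => c) :=
  ⟨fun _ _ => PowerSeries.C c, ⟨fun _ _ _ _ _ _ _ => by simp,
    ⟨‖c‖, norm_nonneg c, fun _ => Eventually.of_forall fun _ _ _ _ _ => .const c⟩,
    fun _ _ _ _ _ _ _ _ => .const c⟩⟩

lemma sub (hφ : IsContracting φ) (hψ : IsContracting ψ) :
    IsContracting (fun z x y => φ z x y - ψ z x y) := by
  convert hφ.add ((const (-1)).mul hψ) using 4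
  ring

lemma geometric : IsContracting (fun z _ _ => (1 - z)⁻¹) := by
  refine ⟨fun _ _ => PowerSeries.mk fun _ => 1, ⟨fun _ _ _ _ _ _ _ => by simp,
    ⟨2, two_pos.le, fun _ => ?_⟩, fun _ _ _ _ _ hz _ _ => .geometric hz⟩⟩
  filter_upwards [self_mem_nhdsWithin,
    nhdsWithin_le_nhds (Iic_mem_nhds (show (0 : ℝ) < 1 / 2 by norm_num))] with r hr hr' _ _ _ _
  exact .geometric (le_of_lt hr) hr'

lemma monomial (i j : ℕ) : IsContracting (fun z x y => z * (x ^ i * y ^ j)) := by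
  refine ⟨fun U V => X * (U ^ i * V ^ j), ⟨fun k U U' V V' hU hV => ?_,
    ⟨1, one_pos.le, fun ρ => ?_⟩,
    fun z x y U V _ hU hV => SumsTo.X.mul ((hU.pow i).mul (hV.pow j))⟩⟩
  · have : X * (U ^ i * V ^ j) - X * (U' ^ i * V' ^ j) =
        X * (U ^ i * (V ^ j - V' ^ j) + (U ^ i - U' ^ i) * V' ^ j) := by ring
    rw [this, pow_succ']
    exact mul_dvd_mul_left _ (dvd_add ((hV.trans (sub_dvd_pow_sub_pow _ _ _)).mul_left _)
      ((hU.trans (sub_dvd_pow_sub_pow _ _ _)).mul_right _))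
  · have h : Tendsto (fun r : ℝ => r * (ρ ^ i * ρ ^ j)) (𝓝 0) (𝓝 0) :=
      Continuous.tendsto' (by fun_prop) _ _ (by simp)
    filter_upwards [self_mem_nhdsWithin, nhdsWithin_le_nhds (h (Iic_mem_nhds one_pos))]
      with r hr hr' U V hU hV
    have hr₀ : 0 ≤ r := le_of_lt hr
    exact (WeightedNormLE.X.mul hr₀ ((hU.pow hr₀ i).mul hr₀ (hV.pow hr₀ j))).mono hr'

end IsContracting

/-- A sequence `(i (n + 1) + j) / ((n + 1) ^ 2 - δ ^ 2)` without poles is bounded. -/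
lemma exists_norm_resolvent_le (i j δ : ℂ) :
    ∃ B : ℝ, 0 ≤ B ∧ ∀ n : ℕ, ‖(i * ((n : ℂ) + 1) + j) / (((n : ℂ) + 1) ^ 2 - δ ^ 2)‖ ≤ B := by
  have hinv : Tendsto (fun n : ℕ => ((n : ℂ) + 1)⁻¹) atTop (𝓝 0) := by
    simpa [one_div] using tendsto_one_div_add_atTop_nhds_zero_nat (𝕜 := ℂ)
  have h : Tendsto (fun n : ℕ => (i * ((n : ℂ) + 1)⁻¹ + j * ((n : ℂ) + 1)⁻¹ ^ 2) /
      (1 - δ ^ 2 * ((n : ℂ) + 1)⁻¹ ^ 2)) atTop (𝓝 ((i * 0 + j * 0 ^ 2) / (1 - δ ^ 2 * 0 ^ 2))) :=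
    Tendsto.div ((hinv.const_mul i).add ((hinv.pow 2).const_mul j))
      (((hinv.pow 2).const_mul _).const_sub 1) (by simp)
  obtain ⟨B, hB⟩ := h.norm.bddAbove_range
  refine ⟨B, (norm_nonneg _).trans (hB ⟨0, rfl⟩), fun n => ?_⟩
  refine le_of_eq_of_le ?_ (hB ⟨n, rfl⟩)
  have hn : (n : ℂ) + 1 ≠ 0 := Nat.cast_add_one_ne_zero n
  dsimp only
  congr 1
  rw [← mul_div_mul_right _ _ (pow_ne_zero 2 (inv_ne_zero hn))]
  congr 1 <;> field_simp

/-- Coefficientwise linear combination of two power series. -/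
noncomputable def coeffCombine (a b : ℕ → ℂ) (f g : ℂ⟦X⟧) : ℂ⟦X⟧ :=
  PowerSeries.mk fun n => a n * coeff n f + b n * coeff n g

lemma X_pow_dvd_coeffCombine_sub {a b : ℕ → ℂ} {f f' g g' : ℂ⟦X⟧} {k : ℕ}
    (hf : X ^ k ∣ f - f') (hg : X ^ k ∣ g - g') :
    X ^ k ∣ coeffCombine a b f g - coeffCombine a b f' g' := by
  rw [X_pow_dvd_iff] at *
  intro n hn
  have h₁ := hf n hn
  have h₂ := hg n hn
  rw [map_sub, sub_eq_zero] at h₁ h₂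
  simp [coeffCombine, h₁, h₂]

lemma WeightedNormLE.coeffCombine {a b : ℕ → ℂ} {f g : ℂ⟦X⟧} {r A B C D : ℝ} (hr : 0 ≤ r)
    (ha : ∀ n, ‖a n‖ ≤ A) (hb : ∀ n, ‖b n‖ ≤ B)
    (hf : WeightedNormLE r f C) (hg : WeightedNormLE r g D) :
    WeightedNormLE r (coeffCombine a b f g) (A * C + B * D) := by
  refine of_le hr ((hf.1.mul_left A).add (hg.1.mul_left B)) ?_ fun n => ?_
  · rw [(hf.1.mul_left A).tsum_add (hg.1.mul_left B), tsum_mul_left, tsum_mul_left]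
    have hA := (norm_nonneg _).trans (ha 0)
    have hB := (norm_nonneg _).trans (hb 0)
    gcongr
    exacts [hf.2, hg.2]
  · rw [← mul_assoc, ← mul_assoc, ← add_mul, MeromorphicGerm.coeffCombine, coeff_mk]
    gcongr
    refine (norm_add_le _ _).trans ?_
    rw [norm_mul, norm_mul]
    gcongr
    exacts [ha n, hb n]

/-- An `X`-adically contracting map on pairs of power series that preserves a weighted `ℓ¹` ball
has a fixed point with summable weighted coefficients. -/
lemma exists_fixedPoint_summable {Φ Ψ : ℂ⟦X⟧ → ℂ⟦X⟧ → ℂ⟦X⟧} {r ρ : ℝ} (hr : 0 ≤ r) (hρ : 0 ≤ ρ)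
    (hΦ : ∀ (k : ℕ) (U U' V V' : ℂ⟦X⟧), X ^ k ∣ U - U' → X ^ k ∣ V - V' →
      X ^ (k + 1) ∣ Φ U V - Φ U' V')
    (hΨ : ∀ (k : ℕ) (U U' V V' : ℂ⟦X⟧), X ^ k ∣ U - U' → X ^ k ∣ V - V' →
      X ^ (k + 1) ∣ Ψ U V - Ψ U' V')
    (hball : ∀ U V, WeightedNormLE r U ρ → WeightedNormLE r V ρ →
      WeightedNormLE r (Φ U V) ρ ∧ WeightedNormLE r (Ψ U V) ρ) :
    ∃ U V, Φ U V = U ∧ Ψ U V = V ∧ Summable (fun n => ‖coeff n U‖ * r ^ n) ∧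
      Summable (fun n => ‖coeff n V‖ * r ^ n) := by
  let w : ℕ → ℂ⟦X⟧ × ℂ⟦X⟧ := fun k => (fun p => (Φ p.1 p.2, Ψ p.1 p.2))^[k] (0, 0)
  have hw : ∀ k, w (k + 1) = (Φ (w k).1 (w k).2, Ψ (w k).1 (w k).2) := fun k =>
    Function.iterate_succ_apply' _ _ _
  have hstep : ∀ k, X ^ k ∣ (w (k + 1)).1 - (w k).1 ∧ X ^ k ∣ (w (k + 1)).2 - (w k).2 := by
    intro k
    induction k with
    | zero => simp
    | succ k ih =>
      rw [hw (k + 1), hw k]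
      rw [hw k] at ih
      exact ⟨hΦ k _ _ _ _ ih.1 ih.2, hΨ k _ _ _ _ ih.1 ih.2⟩
  have hle : ∀ k m, k ≤ m → X ^ k ∣ (w m).1 - (w k).1 ∧ X ^ k ∣ (w m).2 - (w k).2 := by
    intro k m hkm
    induction m, hkm using Nat.le_induction with
    | base => simp
    | succ m hkm ih =>
      have h := pow_dvd_pow (X : ℂ⟦X⟧) hkm
      refine ⟨?_, ?_⟩
      · simpa using dvd_add (h.trans (hstep m).1) ih.1
      · simpa using dvd_add (h.trans (hstep m).2) ih.2
  have hnorm : ∀ k, WeightedNormLE r (w k).1 ρ ∧ WeightedNormLE r (w k).2 ρ := by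
    intro k
    induction k with
    | zero =>
      have : WeightedNormLE r 0 ρ := by simpa [WeightedNormLE] using hρ
      exact ⟨this, this⟩
    | succ k ih =>
      rw [hw k]
      exact hball _ _ ih.1 ih.2
  let U : ℂ⟦X⟧ := PowerSeries.mk fun n => coeff n (w (n + 1)).1
  let V : ℂ⟦X⟧ := PowerSeries.mk fun n => coeff n (w (n + 1)).2
  have hU : ∀ k, X ^ k ∣ U - (w k).1 := fun k => by
    refine X_pow_dvd_iff.2 fun n hn => ?_
    have := X_pow_dvd_iff.1 (hle (n + 1) k hn).1 n n.lt_succ_self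
    rw [map_sub, sub_eq_zero] at this
    simp [U, this]
  have hV : ∀ k, X ^ k ∣ V - (w k).2 := fun k => by
    refine X_pow_dvd_iff.2 fun n hn => ?_
    have := X_pow_dvd_iff.1 (hle (n + 1) k hn).2 n n.lt_succ_self
    rw [map_sub, sub_eq_zero] at this
    simp [V, this]
  have heq : ∀ f g : ℂ⟦X⟧, (∀ k, X ^ (k + 1) ∣ f - g) → f = g := fun f g h => by
    ext n
    have := X_pow_dvd_iff.1 (h n) n n.lt_succ_self
    rwa [map_sub, sub_eq_zero] at this
  have hsum : ∀ (f : ℂ⟦X⟧) (g : ℕ → ℂ⟦X⟧), (∀ k, X ^ k ∣ f - g k) →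
      (∀ k, WeightedNormLE r (g k) ρ) → Summable (fun n => ‖coeff n f‖ * r ^ n) := by
    intro f g hfg hg
    refine summable_of_sum_range_le (c := ρ) (fun n => by positivity) fun N => ?_
    refine le_trans (le_of_eq ?_)
      (((hg N).1.sum_le_tsum (Finset.range N) fun n _ => by positivity).trans (hg N).2)
    refine Finset.sum_congr rfl fun n hn => ?_
    have := X_pow_dvd_iff.1 (hfg N) n (Finset.mem_range.1 hn)
    rw [map_sub, sub_eq_zero] at this
    rw [this]
  refine ⟨U, V, heq _ _ fun k => ?_, heq _ _ fun k => ?_,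
    hsum U _ hU fun k => (hnorm k).1, hsum V _ hV fun k => (hnorm k).2⟩
  · have h₁ := hU (k + 1)
    rw [hw k] at h₁
    simpa using dvd_sub (hΦ k _ _ _ _ (hU k) (hV k)) h₁
  · have h₁ := hV (k + 1)
    rw [hw k] at h₁
    simpa using dvd_sub (hΨ k _ _ _ _ (hU k) (hV k)) h₁

/-- The sum of a power series with summable weighted coefficients is differentiable on the ball,
and its Euler derivative is obtained termwise. -/
lemma differentiableOn_and_hasSum_euler {f : ℂ⟦X⟧} {r : ℝ}
    (hf : Summable (fun n => ‖coeff n f‖ * r ^ n)) :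
    DifferentiableOn ℂ (fun z => ∑' n, coeff n f * z ^ n) (Metric.ball 0 r) ∧
      ∀ z ∈ Metric.ball (0 : ℂ) r, SumsTo f z (∑' n, coeff n f * z ^ n) ∧
        HasSum (fun n : ℕ => (n : ℂ) * (coeff n f * z ^ n))
          (z * deriv (fun z => ∑' n, coeff n f * z ^ n) z) := by
  have hle : ∀ (n : ℕ) (z : ℂ), z ∈ Metric.ball (0 : ℂ) r →
      ‖coeff n f * z ^ n‖ ≤ ‖coeff n f‖ * r ^ n := by
    intro n z hz
    rw [norm_mul, norm_pow]
    gcongr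
    exact (mem_ball_zero_iff.1 hz).le
  have hd : ∀ n : ℕ, DifferentiableOn ℂ (fun z : ℂ => coeff n f * z ^ n) (Metric.ball 0 r) :=
    fun n => by fun_prop
  refine ⟨Complex.differentiableOn_tsum_of_summable_norm hf hd Metric.isOpen_ball hle,
    fun z hz => ⟨?_, ?_⟩⟩
  · exact (Summable.of_norm_bounded hf fun n => hle n z hz).hasSum
  · have h := (Complex.hasSum_deriv_of_summable_norm hf hd Metric.isOpen_ball hle hz).mul_left z
    refine h.congr_fun fun n => ?_
    rw [deriv_const_mul_field, deriv_pow_field]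
    rcases n with _ | n
    · simp
    · simp [pow_succ]
      ring

/-- A Briot–Bouquet theorem: the system `(z d/dz + 1 - A) (x, y) = (φ, ψ)`, where `A` is a traceless
`2 × 2` matrix none of whose eigenvalues `±δ` is a positive integer, has a holomorphic solution
near `0` if `φ` and `ψ` are contracting. -/
theorem exists_holomorphic_solution_of_isContracting {a b c δ : ℂ} {φ ψ : ℂ → ℂ → ℂ → ℂ}
    (hA : a ^ 2 + b * c = δ ^ 2) (hδ : ∀ n : ℕ, ((n : ℂ) + 1) ^ 2 - δ ^ 2 ≠ 0)
    (hφ : IsContracting φ) (hψ : IsContracting ψ) :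
    ∃ (r : ℝ) (x y : ℂ → ℂ), 0 < r ∧ r < 1 ∧ DifferentiableOn ℂ x (Metric.ball 0 r) ∧
      DifferentiableOn ℂ y (Metric.ball 0 r) ∧ ∀ z ∈ Metric.ball (0 : ℂ) r,
        z * deriv x z + x z = a * x z + b * y z + φ z (x z) (y z) ∧
        z * deriv y z + y z = c * x z - a * y z + ψ z (x z) (y z) := by
  obtain ⟨F, hF⟩ := hφ
  obtain ⟨G, hG⟩ := hψ
  obtain ⟨C, hC, hFC⟩ := hF.bound
  obtain ⟨D, hD, hGD⟩ := hG.bound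
  obtain ⟨B₁, hB₁, h₁⟩ := exists_norm_resolvent_le 1 a δ
  obtain ⟨B₂, hB₂, h₂⟩ := exists_norm_resolvent_le 0 b δ
  obtain ⟨B₃, hB₃, h₃⟩ := exists_norm_resolvent_le 0 c δ
  obtain ⟨B₄, hB₄, h₄⟩ := exists_norm_resolvent_le 1 (-a) δ
  let ρ := (B₁ * C + B₂ * D) + (B₃ * C + B₄ * D)
  obtain ⟨r, ⟨hFr, hGr⟩, hr, hr₁⟩ := (((hFC ρ).and (hGD ρ)).and
    (Ioo_mem_nhdsGT (one_pos : (0 : ℝ) < 1))).exists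
  let Φ : ℂ⟦X⟧ → ℂ⟦X⟧ → ℂ⟦X⟧ := fun U V => coeffCombine
    (fun n => (1 * ((n : ℂ) + 1) + a) / (((n : ℂ) + 1) ^ 2 - δ ^ 2))
    (fun n => (0 * ((n : ℂ) + 1) + b) / (((n : ℂ) + 1) ^ 2 - δ ^ 2)) (F U V) (G U V)
  let Ψ : ℂ⟦X⟧ → ℂ⟦X⟧ → ℂ⟦X⟧ := fun U V => coeffCombine
    (fun n => (0 * ((n : ℂ) + 1) + c) / (((n : ℂ) + 1) ^ 2 - δ ^ 2))
    (fun n => (1 * ((n : ℂ) + 1) + -a) / (((n : ℂ) + 1) ^ 2 - δ ^ 2)) (F U V) (G U V)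
  obtain ⟨U, V, hU, hV, hUs, hVs⟩ := exists_fixedPoint_summable (Φ := Φ) (Ψ := Ψ) (ρ := ρ) hr.le
    (by positivity)
    (fun k U U' V V' hU hV =>
      X_pow_dvd_coeffCombine_sub (hF.dvd k U U' V V' hU hV) (hG.dvd k U U' V V' hU hV))
    (fun k U U' V V' hU hV =>
      X_pow_dvd_coeffCombine_sub (hF.dvd k U U' V V' hU hV) (hG.dvd k U U' V V' hU hV))
    (fun U V hU hV =>
      ⟨(WeightedNormLE.coeffCombine hr.le h₁ h₂ (hFr U V hU hV) (hGr U V hU hV)).mono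
          (le_add_of_nonneg_right (by positivity)),
        (WeightedNormLE.coeffCombine hr.le h₃ h₄ (hFr U V hU hV) (hGr U V hU hV)).mono
          (le_add_of_nonneg_left (by positivity))⟩)
  obtain ⟨hUd, hUe⟩ := differentiableOn_and_hasSum_euler hUs
  obtain ⟨hVd, hVe⟩ := differentiableOn_and_hasSum_euler hVs
  have hcoeff : ∀ n : ℕ,
      (n : ℂ) * coeff n U + coeff n U = a * coeff n U + b * coeff n V + coeff n (F U V) ∧
      (n : ℂ) * coeff n V + coeff n V = c * coeff n U - a * coeff n V + coeff n (G U V) := by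
    intro n
    have e₁ : coeff n (Φ U V) = coeff n U := by rw [hU]
    have e₂ : coeff n (Ψ U V) = coeff n V := by rw [hV]
    simp only [Φ, Ψ, coeffCombine, coeff_mk] at e₁ e₂
    have hn := hδ n
    rw [div_mul_eq_mul_div, div_mul_eq_mul_div, ← add_div, div_eq_iff hn] at e₁ e₂
    constructor <;> apply mul_right_cancel₀ hn
    · linear_combination b * e₂ - ((n : ℂ) + 1 - a) * e₁ - coeff n (F U V) * hA
    · linear_combination c * e₁ - ((n : ℂ) + 1 + a) * e₂ - coeff n (G U V) * hA
  refine ⟨r, _, _, hr, hr₁, hUd, hVd, fun z hz => ?_⟩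
  obtain ⟨hUz, hUz'⟩ := hUe z hz
  obtain ⟨hVz, hVz'⟩ := hVe z hz
  have hz₁ : ‖z‖ < 1 := (mem_ball_zero_iff.1 hz).trans hr₁
  have hFz := hF.sumsTo z _ _ U V hz₁ hUz hVz
  have hGz := hG.sumsTo z _ _ U V hz₁ hUz hVz
  unfold SumsTo at hUz hVz hFz hGz
  refine ⟨(hUz'.add hUz).unique ?_, (hVz'.add hVz).unique ?_⟩
  · refine HasSum.congr_fun (((hUz.mul_left a).add (hVz.mul_left b)).add hFz) fun n => ?_
    linear_combination z ^ n * (hcoeff n).1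
  · refine HasSum.congr_fun (((hUz.mul_left c).sub (hVz.mul_left a)).add hGz) fun n => ?_
    linear_combination z ^ n * (hcoeff n).2

/-- The nonlinear terms of the system for `(x, y)` given by `q = z (a + z x)` and
`p = (d + z y) / z`, where `κ₁ = a d` and `κ₂ = (a - 1) d`. -/
lemma isContracting_reduced_PVI (a d k₁ k₂ k₃ e : ℂ) :
    IsContracting (fun z x y =>
      2 * ((2 * a - 1) * (z * (x * y)) + d * (z * (x * x)) + z * (x * x) * (z * y)) +
      (-2 * (a + z * x) * (a + z * x) * (a + z * x - 1) * (d + z * y)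
        + (k₁ + k₃) * (a + z * x) * (a + z * x - 1) + (k₂ - 1) * (a + z * x) * (a + z * x)
        + (a + z * x) + 2 * (a + z * x) * (a + z * x - 1) * (d + z * y)
        - k₁ * (a + z * x - 1) - k₂ * (a + z * x)) * (1 - z)⁻¹) ∧
    IsContracting (fun z x y =>
      -1 * ((2 * a - 1) * (z * (y * y)) + 4 * d * (z * (x * y)) + 2 * (z * x) * (z * (y * y))) +
      ((3 * (a + z * x) * (a + z * x) - 2 * (a + z * x)) * (d + z * y) * (d + z * y)
        - ((k₁ + k₃) * (2 * (a + z * x) - 1) + (k₂ - 1) * (2 * (a + z * x))) * (d + z * y)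
        + e - (d + z * y) - (2 * (a + z * x) - 1) * (d + z * y) * (d + z * y)
        + (k₁ + k₂) * (d + z * y)) * (1 - z)⁻¹) := by
  have hx : IsContracting (fun z x _ => z * x) := by simpa using IsContracting.monomial 1 0
  have hy : IsContracting (fun z _ y => z * y) := by simpa using IsContracting.monomial 0 1
  have hxx : IsContracting (fun z x _ => z * (x * x)) := by
    simpa [sq] using IsContracting.monomial 2 0
  have hxy : IsContracting (fun z x y => z * (x * y)) := by
    simpa using IsContracting.monomial 1 1
  have hyy : IsContracting (fun z _ y => z * (y * y)) := by
    simpa [sq] using IsContracting.monomial 0 2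
  constructor <;>
  repeat' first
    | exact IsContracting.const _
    | exact IsContracting.geometric
    | exact hx
    | exact hy
    | exact hxx
    | exact hxy
    | exact hyy
    | apply IsContracting.add
    | apply IsContracting.sub
    | apply IsContracting.mul

end MeromorphicGerm

/-- If `κ₁ − κ₂ ∉ ℤ`, Painlevé VI admits a meromorphic solution germ at `z = 0` with
`q(z) = κ₁ z/(κ₁−κ₂) + O(z²)` and `p` having a simple pole at `z = 0` with residue
`κ₁ − κ₂`. -/
theorem meromorphic_solution_germ_k1_minus_k2
    (κ₀ κ₁ κ₂ κ₃ κ₄ : ℂ) (hκ : 2 * κ₀ + κ₁ + κ₂ + κ₃ + κ₄ = 1)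
    (h : ∀ m : ℤ, κ₁ - κ₂ ≠ (m : ℂ)) :
    ∃ (r : ℝ) (q p₀ : ℂ → ℂ), 0 < r ∧ r < 1 ∧
      (∀ z ∈ Metric.ball (0 : ℂ) r, AnalyticAt ℂ q z) ∧
      (∀ z ∈ Metric.ball (0 : ℂ) r, AnalyticAt ℂ p₀ z) ∧
      q 0 = 0 ∧ deriv q 0 = κ₁ / (κ₁ - κ₂) ∧
      ∀ z ∈ Metric.ball (0 : ℂ) r, z ≠ 0 →
        SolvesPVIAt κ₀ κ₁ κ₂ κ₃ κ₄ q (fun w => (κ₁ - κ₂) / w + p₀ w) z := by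
  obtain ⟨d, hd⟩ : ∃ d, d = κ₁ - κ₂ := ⟨_, rfl⟩
  have hd₀ : d ≠ 0 := by simpa [hd] using h 0
  obtain ⟨a, ha⟩ : ∃ a, a = κ₁ / d := ⟨_, rfl⟩
  have hκ₁ : κ₁ = a * d := by rw [ha, div_mul_cancel₀ _ hd₀]
  have hκ₂ : κ₂ = (a - 1) * d := by linear_combination hκ₁ + hd
  have hδ : ∀ n : ℕ, ((n : ℂ) + 1) ^ 2 - d ^ 2 ≠ 0 := by
    intro n hn
    rw [sq_sub_sq, mul_eq_zero] at hn
    rcases hn with hn | hn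
    · refine h (-(n + 1)) ?_
      push_cast
      linear_combination hn - hd
    · refine h (n + 1) ?_
      push_cast
      linear_combination -hn - hd
  obtain ⟨hφ, hψ⟩ :=
    MeromorphicGerm.isContracting_reduced_PVI a d κ₁ κ₂ κ₃ (κ₀ * (κ₀ + κ₄))
  obtain ⟨r, x, y, hr, hr₁, hx, hy, hxy⟩ :=
    MeromorphicGerm.exists_holomorphic_solution_of_isContracting
    (a := κ₁ + κ₂) (b := 2 * a * (a - 1)) (c := -2 * d ^ 2) (δ := d)
    (by rw [hκ₁, hκ₂]; ring) hδ hφ hψ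
  have hxa : ∀ z ∈ Metric.ball (0 : ℂ) r, AnalyticAt ℂ x z := fun z hz =>
    hx.analyticAt (Metric.isOpen_ball.mem_nhds hz)
  have hya : ∀ z ∈ Metric.ball (0 : ℂ) r, AnalyticAt ℂ y z := fun z hz =>
    hy.analyticAt (Metric.isOpen_ball.mem_nhds hz)
  have hq : ∀ z ∈ Metric.ball (0 : ℂ) r, HasDerivAt (fun w => w * (a + w * x w))
      (1 * (a + z * x z) + z * (1 * x z + z * deriv x z)) z := fun z hz =>
    (hasDerivAt_id' z).mul
      (((hasDerivAt_id' z).mul (hxa z hz).differentiableAt.hasDerivAt).const_add a)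
  refine ⟨r, fun w => w * (a + w * x w), y, hr, hr₁, fun z hz => ?_, hya, by simp, ?_,
    fun z hz hz₀ => ?_⟩
  · have := hxa z hz
    fun_prop
  · rw [(hq 0 (Metric.mem_ball_self hr)).deriv, ← hd, ha]
    ring
  · have hp : HasDerivAt (fun w => (κ₁ - κ₂) / w + y w)
        ((κ₁ - κ₂) * -(z ^ 2)⁻¹ + deriv y z) z := by
      simp only [div_eq_mul_inv]
      exact ((hasDerivAt_inv hz₀).const_mul _).add (hya z hz).differentiableAt.hasDerivAt
    have hz₁ : 1 - z ≠ 0 := by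
      rw [sub_ne_zero]
      rintro rfl
      simp at hz
      linarith
    obtain ⟨h₁, h₂⟩ := hxy z hz
    unfold SolvesPVIAt
    rw [(hq z hz).deriv, hp.deriv]
    simp only [← hd]
    generalize deriv x z = x' at *
    generalize deriv y z = y' at *
    generalize x z = X at *
    generalize y z = Y at *
    clear hq hp hxy hφ hψ hx hy hxa hya ha hd h hδ
    subst hκ₁ hκ₂
    field_simp at h₁ h₂
    constructor
    · field_simp
      linear_combination (-z) * h₁
    · field_simp
      linear_combination (-z) * h₂
end

section
/- Let κ = (κ₀,κ₁,κ₂,κ₃,κ₄) ∈ ℂ⁵ with 2κ₀+κ₁+κ₂+κ₃+κ₄ = 1 and κ₁ = κ₂ = 0. Then for every t ∈ ℂ there exist r ∈ (0,1) and functions q, p : ℂ → ℂ, both analytic on the ball {z : |z| < r}, such that: (i) (q,p) solves P_VI(κ) at every z with 0 < |z| < r; (ii) the function z ↦ q(z) − t·z/(t + (1−t)(1−z)^{κ₄}) vanishes to order at least 2 at z = 0, and its second Taylor coefficient at 0 equals 2t(1−t)κ₀(κ₀+κ₃); (iii) p(0) = κ₀(κ₀+κ₄). Here (1−z)^{κ₄}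 denotes the principal branch of the complex power (Complex.cpow), which is analytic in z near 0 and takes the value 1 at z = 0, so the denominator t + (1−t)(1−z)^{κ₄} equals 1 at z = 0. -/
open Set Filter Topology Metric

/-- A self-map of the holomorphic functions on `U` with values in a closed ball that halves
uniform bounds on differences has a fixed point. -/
theorem exists_differentiableOn_eqOn_of_contracting {E : Type*} [NormedAddCommGroup E]
    [NormedSpace ℂ E] [CompleteSpace E] {U : Set ℂ} (hU : IsOpen U) {c : E} {ρ : ℝ}
    (hρ : 0 ≤ ρ) (T : (ℂ → E) → (ℂ → E))
    (hT : ∀ v, DifferentiableOn ℂ v U → MapsTo v U (closedBall c ρ) →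
      DifferentiableOn ℂ (T v) U ∧ MapsTo (T v) U (closedBall c ρ))
    (hlip : ∀ v v', DifferentiableOn ℂ v U → MapsTo v U (closedBall c ρ) →
      DifferentiableOn ℂ v' U → MapsTo v' U (closedBall c ρ) →
      ∀ M, (∀ z ∈ U, dist (v z) (v' z) ≤ M) → ∀ z ∈ U, dist (T v z) (T v' z) ≤ M / 2) :
    ∃ v, DifferentiableOn ℂ v U ∧ MapsTo v U (closedBall c ρ) ∧ EqOn (T v) v U := by
  set s : ℕ → ℂ → E := fun n => T^[n] fun _ => c with hs
  have s_succ (n) : s (n + 1) = T (s n) := Function.iterate_succ_apply' T n _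
  have hsS (n) : DifferentiableOn ℂ (s n) U ∧ MapsTo (s n) U (closedBall c ρ) := by
    induction n with
    | zero => exact ⟨differentiableOn_const c, fun z _ => mem_closedBall_self hρ⟩
    | succ n ih => rw [s_succ]; exact hT _ ih.1 ih.2
  have hstep (n) : ∀ z ∈ U, dist (s n z) (s (n + 1) z) ≤ 2 * ρ / 2 / 2 ^ n := by
    induction n with
    | zero =>
      intro z hz
      have := (hsS 1).2 hz
      rw [mem_closedBall, dist_comm] at this
      simpa [hs] using this
    | succ n ih =>
      intro z hz
      rw [s_succ (n + 1), pow_succ, ← div_div]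
      nth_rewrite 1 [s_succ n]
      exact hlip _ _ (hsS n).1 (hsS n).2 (hsS (n + 1)).1 (hsS (n + 1)).2 _ ih z hz
  have hlim : ∀ z, ∃ a, z ∈ U → Tendsto (fun n => s n z) atTop (𝓝 a) := by
    intro z
    by_cases hz : z ∈ U
    · obtain ⟨a, ha⟩ := cauchySeq_tendsto_of_complete
        (cauchySeq_of_le_geometric_two fun n => hstep n z hz)
      exact ⟨a, fun _ => ha⟩
    · exact ⟨c, fun h => absurd h hz⟩
  choose v hv using hlim
  have hdist (n) : ∀ z ∈ U, dist (s n z) (v z) ≤ 2 * ρ / 2 ^ n := fun z hz =>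
    dist_le_of_le_geometric_two_of_tendsto (fun n => hstep n z hz) (hv z hz) n
  have hzero : Tendsto (fun n : ℕ => 2 * ρ / 2 ^ n) atTop (𝓝 0) :=
    tendsto_const_nhds.div_atTop (tendsto_pow_atTop_atTop_of_one_lt one_lt_two)
  have hunif : TendstoUniformlyOn s v atTop U := by
    rw [Metric.tendstoUniformlyOn_iff]
    intro ε hε
    filter_upwards [hzero.eventually_lt_const hε] with n hn z hz
    rw [dist_comm]
    exact (hdist n z hz).trans_lt hn
  have hvd : DifferentiableOn ℂ v U :=
    hunif.tendstoLocallyUniformlyOn.differentiableOn (.of_forall fun n => (hsS n).1) hU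
  have hvm : MapsTo v U (closedBall c ρ) := fun z hz =>
    isClosed_closedBall.mem_of_tendsto (hv z hz) (.of_forall fun n => (hsS n).2 hz)
  refine ⟨v, hvd, hvm, fun z hz => ?_⟩
  refine (tendsto_nhds_unique (hv z hz) ?_).symm
  rw [← tendsto_add_atTop_iff_nat 1, tendsto_iff_dist_tendsto_zero]
  refine squeeze_zero (fun _ => dist_nonneg) (fun n => ?_) (by simpa using hzero.div_const 2)
  rw [s_succ]
  exact hlip _ _ (hsS n).1 (hsS n).2 hvd hvm _ (hdist n) z hz

theorem norm_le_mul_norm_of_hasDerivAt {f g : ℂ → ℂ} {r M : ℝ} (hg0 : g 0 = 0)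
    (hg : ∀ z ∈ ball (0 : ℂ) r, HasDerivAt g (f z) z) (hM : ∀ z ∈ ball (0 : ℂ) r, ‖f z‖ ≤ M)
    {z : ℂ} (hz : z ∈ ball (0 : ℂ) r) : ‖g z‖ ≤ M * ‖z‖ := by
  have h0 : (0 : ℂ) ∈ ball (0 : ℂ) r := mem_ball_self (pos_of_mem_ball hz)
  simpa [hg0] using (convex_ball (0 : ℂ) r).norm_image_sub_le_of_norm_hasDerivWithin_le
    (fun x hx => (hg x hx).hasDerivWithinAt) hM h0 hz

theorem norm_le_mul_of_hasDerivAt_id_mul {f w : ℂ → ℂ} {r M : ℝ} (hw0 : w 0 = 0)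
    (hw : ∀ z ∈ ball (0 : ℂ) r, HasDerivAt (fun z => z * w z) (z * f z) z)
    (hM : ∀ z ∈ ball (0 : ℂ) r, ‖f z‖ ≤ M) {z : ℂ} (hz : z ∈ ball (0 : ℂ) r) :
    ‖w z‖ ≤ M * r := by
  have hr := pos_of_mem_ball hz
  have hM0 : 0 ≤ M := (norm_nonneg _).trans (hM z hz)
  rcases eq_or_ne z 0 with rfl | hne
  · rw [hw0, norm_zero]; positivity
  have key := norm_le_mul_norm_of_hasDerivAt (M := r * M) (by simp) hw
    (fun x hx => by
      rw [norm_mul]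
      exact mul_le_mul (mem_ball_zero_iff.1 hx).le (hM x hx) (norm_nonneg _) hr.le) hz
  rw [norm_mul, mul_comm] at key
  rw [mul_comm M]
  exact le_of_mul_le_mul_right key (norm_pos_iff.2 hne)

theorem exists_hasDerivAt_id_mul {f : ℂ → ℂ} {r : ℝ} (hr : 0 < r)
    (hf : DifferentiableOn ℂ f (ball 0 r)) :
    ∃ w : ℂ → ℂ, DifferentiableOn ℂ w (ball 0 r) ∧ w 0 = 0 ∧
      ∀ z ∈ ball (0 : ℂ) r, HasDerivAt (fun z => z * w z) (z * f z) z := by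
  obtain ⟨g, hg0, hg⟩ :=
    (DifferentiableOn.isExactOn_ball (differentiableOn_id.mul hf)).with_val_at 0 0
  have hgw : (fun z => z * dslope g 0 z) = g := by
    ext z
    simpa [hg0] using sub_smul_dslope g 0 z
  have h0 : (0 : ℂ) ∈ ball (0 : ℂ) r := mem_ball_self hr
  refine ⟨dslope g 0, ?_, ?_, ?_⟩
  · rw [Complex.differentiableOn_dslope (ball_mem_nhds 0 hr)]
    exact fun z hz => (hg z hz).differentiableAt.differentiableWithinAt
  · rw [dslope_same, (hg 0 h0).deriv]; simp
  · rw [hgw]; exact hg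

/-- Local holomorphic solvability of the singular system `u' = F(z, u, w)`,
`(z w)' = z G(z, u, w)` with `u(0) = a`, `w(0) = 0`. -/
theorem exists_holomorphic_solution_singular_system {F G : ℂ × ℂ × ℂ → ℂ} {a : ℂ}
    (hF : AnalyticAt ℂ F (0, a, 0)) (hG : AnalyticAt ℂ G (0, a, 0)) :
    ∃ r > 0, ∃ u w : ℂ → ℂ, u 0 = a ∧ w 0 = 0 ∧ DifferentiableOn ℂ w (ball 0 r) ∧
      (∀ z ∈ ball (0 : ℂ) r, HasDerivAt u (F (z, u z, w z)) z) ∧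
      ∀ z ∈ ball (0 : ℂ) r, HasDerivAt (fun z => z * w z) (z * G (z, u z, w z)) z := by
  have hH : AnalyticAt ℂ (fun x => (F x, G x)) (0, a, 0) := hF.prod hG
  obtain ⟨K, s, hs, hK⟩ :=
    (hH.contDiffAt (n := 1)).exists_lipschitzOnWith
  set M : ℝ := ‖(F (0, a, 0), G (0, a, 0))‖ + 1
  have hb : ∀ᶠ x in 𝓝 ((0, a, 0) : ℂ × ℂ × ℂ), ‖(F x, G x)‖ < M :=
    hH.continuousAt.norm.eventually_lt_const (lt_add_one _)
  obtain ⟨δ, hδ, hδs⟩ := Metric.nhds_basis_closedBall.mem_iff.1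
    (inter_mem hs (hb.and hH.eventually_analyticAt))
  have hMpos : 0 < M := by positivity
  obtain ⟨r, hr, hrδ, hrM, hrK⟩ : ∃ r > 0, r ≤ δ ∧ M * r ≤ δ ∧ K * r ≤ 1 / 2 := by
    have h1 : ∀ᶠ r in 𝓝[>] (0 : ℝ), r < δ :=
      (continuous_id.tendsto' 0 0 rfl).mono_left inf_le_left |>.eventually_lt_const hδ
    have h2 : ∀ᶠ r in 𝓝[>] (0 : ℝ), M * r < δ :=
      ((continuous_const_mul M).tendsto' 0 0 (mul_zero M)).mono_left inf_le_left
        |>.eventually_lt_const hδ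
    have h3 : ∀ᶠ r : ℝ in 𝓝[>] 0, K * r < 1 / 2 :=
      ((continuous_const_mul (K : ℝ)).tendsto' 0 0 (mul_zero _)).mono_left inf_le_left
        |>.eventually_lt_const one_half_pos
    obtain ⟨r, hr, h1, h2, h3⟩ := (eventually_mem_nhdsWithin.and (h1.and (h2.and h3))).exists
    exact ⟨r, hr, h1.le, h2.le, h3.le⟩
  set U := ball (0 : ℂ) r
  have hmem {z : ℂ} {y : ℂ × ℂ} (hz : z ∈ U) (hy : y ∈ closedBall (a, (0 : ℂ)) δ) :
      (z, y) ∈ closedBall ((0, a, 0) : ℂ × ℂ × ℂ) δ := by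
    rw [← closedBall_prod_same]
    exact ⟨ball_subset_closedBall (ball_subset_ball hrδ hz), hy⟩
  have hcomp {v : ℂ → ℂ × ℂ} (hv : DifferentiableOn ℂ v U)
      (hvm : MapsTo v U (closedBall (a, 0) δ)) :
      DifferentiableOn ℂ (fun z => (F (z, v z), G (z, v z))) U := fun z hz =>
    ((hδs (hmem hz (hvm hz))).2.2.differentiableAt.comp_differentiableWithinAt z
      (differentiableWithinAt_id.prodMk (hv z hz)) :)
  have hex (v : ℂ → ℂ × ℂ) : ∃ v' : ℂ → ℂ × ℂ, DifferentiableOn ℂ v U →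
      MapsTo v U (closedBall (a, 0) δ) → DifferentiableOn ℂ v' U ∧ v' 0 = (a, 0) ∧
      (∀ z ∈ U, HasDerivAt (fun z => (v' z).1) (F (z, v z)) z) ∧
      ∀ z ∈ U, HasDerivAt (fun z => z * (v' z).2) (z * G (z, v z)) z := by
    by_cases h : DifferentiableOn ℂ v U ∧ MapsTo v U (closedBall (a, 0) δ)
    · have hd := hcomp h.1 h.2
      obtain ⟨u, hu0, hu⟩ := (DifferentiableOn.isExactOn_ball hd.fst).with_val_at 0 a
      obtain ⟨w, hwd, hw0, hw⟩ := exists_hasDerivAt_id_mul hr hd.snd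
      refine ⟨fun z => (u z, w z), fun _ _ => ⟨?_, by simp [hu0, hw0], hu, hw⟩⟩
      exact fun z hz => (hu z hz).differentiableAt.differentiableWithinAt.prodMk (hwd z hz)
    · exact ⟨v, fun h1 h2 => absurd ⟨h1, h2⟩ h⟩
  choose T hT using hex
  obtain ⟨v, hv, hvm, hfix⟩ := exists_differentiableOn_eqOn_of_contracting
    (U := U) (c := (a, (0 : ℂ))) (ρ := δ) isOpen_ball hδ.le T
    (fun v hv hvm => by
      obtain ⟨hd, h0, h1, h2⟩ := hT v hv hvm
      refine ⟨hd, fun z hz => ?_⟩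
      have hbd (x) (hx : x ∈ U) := (hδs (hmem hx (hvm hx))).2.1.le
      rw [mem_closedBall, Prod.dist_eq, max_le_iff]
      constructor
      · rw [dist_eq_norm]
        refine le_trans ?_ hrM
        refine (norm_le_mul_norm_of_hasDerivAt (g := fun z => (T v z).1 - a) (by simp [h0])
          (fun x hx => (h1 x hx).sub_const a)
          (fun x hx => (norm_fst_le _).trans (hbd x hx)) hz).trans ?_
        exact mul_le_mul_of_nonneg_left (mem_ball_zero_iff.1 hz).le hMpos.le
      · rw [dist_zero_right]
        exact (norm_le_mul_of_hasDerivAt_id_mul (w := fun z => (T v z).2) (by simp [h0]) h2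
          (fun x hx => (norm_snd_le _).trans (hbd x hx)) hz).trans hrM)
    (fun v v' hv hvm hv' hvm' N hN z hz => by
      obtain ⟨-, h0, h1, h2⟩ := hT v hv hvm
      obtain ⟨-, h0', h1', h2'⟩ := hT v' hv' hvm'
      have hN0 : 0 ≤ N := dist_nonneg.trans (hN z hz)
      have hbd (x) (hx : x ∈ U) :
          ‖(F (x, v x), G (x, v x)) - (F (x, v' x), G (x, v' x))‖ ≤ K * N := by
        rw [← dist_eq_norm]
        refine (hK.dist_le_mul _ (hδs (hmem hx (hvm hx))).1 _
          (hδs (hmem hx (hvm' hx))).1).trans ?_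
        gcongr
        simpa [Prod.dist_eq] using hN x hx
      have hKr : K * N * r ≤ N / 2 := by nlinarith
      rw [Prod.dist_eq, max_le_iff, dist_eq_norm, dist_eq_norm]
      constructor
      · refine le_trans ?_ hKr
        refine (norm_le_mul_norm_of_hasDerivAt (g := fun z => (T v z).1 - (T v' z).1)
          (by simp [h0, h0']) (fun x hx => (h1 x hx).sub (h1' x hx))
          (fun x hx => (norm_fst_le _).trans (hbd x hx)) hz).trans ?_
        exact mul_le_mul_of_nonneg_left (mem_ball_zero_iff.1 hz).le (by positivity)
      · refine (norm_le_mul_of_hasDerivAt_id_mul (w := fun z => (T v z).2 - (T v' z).2)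
          (by simp [h0, h0']) (fun x hx => ?_)
          (fun x hx => (norm_snd_le _).trans (hbd x hx)) hz).trans hKr
        simpa only [mul_sub, Prod.mk_sub_mk] using (h2 x hx).fun_sub (h2' x hx))
  obtain ⟨hd, h0, h1, h2⟩ := hT v hv hvm
  refine ⟨r, hr, fun z => (T v z).1, fun z => (T v z).2, by simp [h0], by simp [h0], hd.snd,
    fun z hz => ?_, fun z hz => ?_⟩
  · simpa only [Prod.mk.eta, hfix hz] using h1 z hz
  · simpa only [Prod.mk.eta, hfix hz] using h2 z hz

/-- If `κ₁ = κ₂ = 0`, Painlevé VI admits a `1`-parameter family of holomorphic solution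
germs at `z = 0` with `q(z) = t z/(t + (1−t)(1−z)^{κ₄}) + 2t(1−t)κ₀(κ₀+κ₃) z² + O(z³)`
and `p(0) = κ₀(κ₀+κ₄)`.  Here `(1−z)^{κ₄}` is the principal branch `Complex.cpow`. -/
theorem holomorphic_solution_family_A1_sq
    (κ₀ κ₁ κ₂ κ₃ κ₄ : ℂ) (hκ : 2 * κ₀ + κ₁ + κ₂ + κ₃ + κ₄ = 1)
    (h₁ : κ₁ = 0) (h₂ : κ₂ = 0) (t : ℂ) :
    ∃ (r : ℝ) (q p h : ℂ → ℂ), 0 < r ∧ r < 1 ∧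
      (∀ z ∈ Metric.ball (0 : ℂ) r, AnalyticAt ℂ q z) ∧
      (∀ z ∈ Metric.ball (0 : ℂ) r, AnalyticAt ℂ p z) ∧
      (∀ z ∈ Metric.ball (0 : ℂ) r, AnalyticAt ℂ h z) ∧
      (∀ z ∈ Metric.ball (0 : ℂ) r,
        q z = t * z / (t + (1 - t) * (1 - z) ^ κ₄) + z ^ 2 * h z) ∧
      h 0 = 2 * t * (1 - t) * κ₀ * (κ₀ + κ₃) ∧
      p 0 = κ₀ * (κ₀ + κ₄) ∧
      ∀ z ∈ Metric.ball (0 : ℂ) r, z ≠ 0 → SolvesPVIAt κ₀ κ₁ κ₂ κ₃ κ₄ q p z := by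
  subst h₁ h₂
  set c := κ₀ * (κ₀ + κ₄)
  set F : ℂ × ℂ × ℂ → ℂ := fun x =>
    x.2.1 * (x.2.1 - 1) * (2 * (x.1 * x.2.1 - 1) * (c + x.2.2) + 1 - κ₃) / (x.1 - 1) with hF
  set G : ℂ × ℂ × ℂ → ℂ := fun x =>
    (-(3 * x.1 * x.2.1 ^ 2 - 2 * (1 + x.1) * x.2.1 + 1) * (c + x.2.2) ^ 2
      + (-2 * x.2.1 + κ₃ * (2 * x.2.1 - 1)) * (c + x.2.2) + x.2.2) / (x.1 - 1)
  have hFa : AnalyticAt ℂ F (0, t, 0) := by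
    refine ContDiffAt.analyticAt (𝕜 := ℂ) (ContDiffAt.div ?_ ?_ (by simp)) <;> fun_prop
  have hGa : AnalyticAt ℂ G (0, t, 0) := by
    refine ContDiffAt.analyticAt (𝕜 := ℂ) (ContDiffAt.div ?_ ?_ (by simp)) <;> fun_prop
  obtain ⟨r₁, hr₁, u, w, hu0, hw0, hwd, hu, hw⟩ :=
    exists_holomorphic_solution_singular_system hFa hGa
  set D : ℂ → ℂ := fun z => t + (1 - t) * (1 - z) ^ κ₄ with hD
  have hDat {z : ℂ} (hz : 1 - z ∈ Complex.slitPlane) :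
      HasDerivAt D ((1 - t) * (κ₄ * (1 - z) ^ (κ₄ - 1) * -1)) z :=
    ((((hasDerivAt_id z).const_sub 1).cpow_const hz).const_mul (1 - t)).const_add t
  have hD0 : D 0 = 1 := by simp [hD]
  have hDderiv : HasDerivAt D (-((1 - t) * κ₄)) 0 := by
    simpa using hDat (z := 0) (by simp)
  obtain ⟨r₂, hr₂, hDne⟩ := Metric.eventually_nhds_iff_ball.1
    (hDderiv.continuousAt.eventually_ne (hD0.trans_ne one_ne_zero))
  obtain ⟨r, hr, hr1, hrr₁, hrr₂⟩ : ∃ r > 0, r < 1 ∧ r ≤ r₁ ∧ r ≤ r₂ :=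
    ⟨min (1 / 2) (min r₁ r₂), by positivity, (min_le_left _ _).trans_lt one_half_lt_one,
      (min_le_right _ _).trans (min_le_left _ _), (min_le_right _ _).trans (min_le_right _ _)⟩
  have hu (z) (hz : z ∈ ball (0 : ℂ) r) := hu z (ball_subset_ball hrr₁ hz)
  have hw (z) (hz : z ∈ ball (0 : ℂ) r) := hw z (ball_subset_ball hrr₁ hz)
  have hDne (z) (hz : z ∈ ball (0 : ℂ) r) := hDne z (ball_subset_ball hrr₂ hz)
  have hwd : DifferentiableOn ℂ w (ball 0 r) := hwd.mono (ball_subset_ball hrr₁)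
  have hud : DifferentiableOn ℂ u (ball 0 r) := fun z hz =>
    (hu z hz).differentiableAt.differentiableWithinAt
  have hDd : DifferentiableOn ℂ D (ball 0 r) := fun z hz => by
    refine (hDat ?_).differentiableAt.differentiableWithinAt
    refine Complex.mem_slitPlane_of_norm_lt_one (z := -z) ?_
    rw [norm_neg]
    exact (mem_ball_zero_iff.1 hz).trans hr1
  have h0 : (0 : ℂ) ∈ ball (0 : ℂ) r := mem_ball_self hr
  set k : ℂ → ℂ := fun z => u z - t / D z with hk
  have hk0 : k 0 = 0 := by simp [hk, hu0, hD0]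
  have hkd : DifferentiableOn ℂ k (ball 0 r) :=
    hud.sub ((differentiableOn_const t).div hDd hDne)
  have analyticAt_of_differentiableOn {f : ℂ → ℂ} (hf : DifferentiableOn ℂ f (ball 0 r)) :
      ∀ z ∈ ball (0 : ℂ) r, AnalyticAt ℂ f z := fun z hz =>
    hf.analyticAt (isOpen_ball.mem_nhds hz)
  refine ⟨r, fun z => z * u z, fun z => c + w z, dslope k 0, hr, hr1,
    analyticAt_of_differentiableOn (differentiableOn_id.mul hud),
    analyticAt_of_differentiableOn (hwd.const_add c),
    analyticAt_of_differentiableOn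
      ((Complex.differentiableOn_dslope (ball_mem_nhds 0 hr)).2 hkd),
    fun z _ => ?_, ?_, by simp [hw0], fun z hz _ => ?_⟩
  · have hkz : z * dslope k 0 z = u z - t / D z := by
      simpa [hk0] using sub_smul_dslope k 0 z
    change z * u z = t * z / D z + z ^ 2 * dslope k 0 z
    linear_combination -z * hkz
  · have hk' := (hu 0 h0).sub ((hasDerivAt_const 0 t).div hDderiv (hDne 0 h0))
    rw [dslope_same]
    refine hk'.deriv.trans ?_
    simp only [hF, hu0, hw0, hD0]
    linear_combination -t * (1 - t) * (1 + 2 * κ₀) * hκ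
  · have hz1 : z - 1 ≠ 0 := by
      rw [sub_ne_zero]
      rintro rfl
      simp only [mem_ball_zero_iff, norm_one] at hz
      exact hz.not_ge hr1.le
    have hq := ((hasDerivAt_id z).fun_mul (hu z hz)).deriv
    have hwz := (hwd.differentiableAt (isOpen_ball.mem_nhds hz)).hasDerivAt
    have hp := (hwz.const_add c).deriv
    have hzw := ((hasDerivAt_id z).fun_mul hwz).unique (hw z hz)
    have hFz : (z - 1) * F (z, u z, w z) =
        u z * (u z - 1) * (2 * (z * u z - 1) * (c + w z) + 1 - κ₃) := mul_div_cancel₀ _ hz1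
    have hGz : (z - 1) * G (z, u z, w z) =
        -(3 * z * u z ^ 2 - 2 * (1 + z) * u z + 1) * (c + w z) ^ 2
          + (-2 * u z + κ₃ * (2 * u z - 1)) * (c + w z) + w z := mul_div_cancel₀ _ hz1
    simp only [id_eq, one_mul] at hq hzw
    unfold SolvesPVIAt
    rw [hq, hp]
    constructor
    · linear_combination z ^ 2 * hFz
    · linear_combination (z - 1) * hzw + z * hGz
end

section
/- Let κ = (κ₀,κ₁,κ₂,κ₃,κ₄) ∈ ℂ⁵ with κ₀ = κ₁ = κ₂ = 0, κ₃ + κ₄ = 1 and κ₄ ≠ 0. Then for every t ∈ ℂ there exist r ∈ (0,1) and functions q, p : ℂ → ℂ, both analytic on the ball {z : |z| < r}, such that: (i) (q,p) solves P_VI(κ) at every z with 0 < |z| < r; (ii) the function z ↦ q(z) − R(z) − tκ₃z vanishes to order at least 2 at z = 0, where R is the analytic extension across z = 0 of z ↦ z/(1 − (1−z)^{κ₄}) (so R(0) = 1/κ₄); (iii) p(0) = 0 and p′(0) = −tκ₄³. -/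
open scoped BoundedContinuousFunction Topology
open Metric

/-- The Banach algebra of bounded continuous functions on `ℂ` that are holomorphic on the open
unit disc. -/
def discAlgebra : Subalgebra ℂ (ℂ →ᵇ ℂ) where
  carrier := {f | DifferentiableOn ℂ f (ball 0 1)}
  mul_mem' hf hg := DifferentiableOn.mul hf hg
  add_mem' hf hg := DifferentiableOn.add hf hg
  algebraMap_mem' c := differentiableOn_const c

lemma isClosed_discAlgebra : IsClosed (discAlgebra : Set (ℂ →ᵇ ℂ)) := by
  refine IsSeqClosed.isClosed fun F f hF hf => ?_
  rw [BoundedContinuousFunction.tendsto_iff_tendstoUniformly] at hf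
  exact hf.tendstoUniformlyOn.tendstoLocallyUniformlyOn.differentiableOn
    (Filter.Eventually.of_forall hF) isOpen_ball

instance : CompleteSpace discAlgebra := isClosed_discAlgebra.completeSpace_coe

lemma discAlgebra_differentiableOn (f : discAlgebra) :
    DifferentiableOn ℂ (f.1 : ℂ → ℂ) (ball 0 1) := f.2

/-- An element of the disc algebra that restricts to the identity on the unit disc. -/
noncomputable def discCoord : discAlgebra :=
  ⟨BoundedContinuousFunction.ofNormedAddCommGroup (fun z : ℂ => ((max 1 ‖z‖ : ℝ) : ℂ)⁻¹ * z)
    (by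
      refine Continuous.mul (Continuous.inv₀ (by fun_prop) fun z => ?_) continuous_id
      exact_mod_cast (lt_of_lt_of_le one_pos (le_max_left 1 ‖z‖)).ne')
    1 (by
      intro z
      have h : 0 < max 1 ‖z‖ := lt_of_lt_of_le one_pos (le_max_left 1 ‖z‖)
      rw [norm_mul, norm_inv, Complex.norm_real, Real.norm_of_nonneg h.le, inv_mul_le_iff₀ h,
        mul_one]
      exact le_max_right _ _),
    by
      refine differentiableOn_id.congr fun z hz => ?_
      have : max 1 ‖z‖ = 1 := max_eq_left (mem_ball_zero_iff.1 hz).le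
      simp [this]⟩

lemma discCoord_apply {z : ℂ} (hz : z ∈ ball (0 : ℂ) 1) : discCoord.1 z = z := by
  have : max 1 ‖z‖ = 1 := max_eq_left (mem_ball_zero_iff.1 hz).le
  simp [discCoord, this]

/-- The weighted average of `f` along the segment from `0` to `z`. -/
noncomputable def radialMean (n : ℕ) (f : ℂ → ℂ) (z : ℂ) : ℂ :=
  ∫ s in (0 : ℝ)..1, (s : ℂ) ^ n * f (s * z)

lemma continuous_radialMean (n : ℕ) {f : ℂ → ℂ} (hf : Continuous f) :
    Continuous (radialMean n f) := by
  unfold radialMean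
  exact intervalIntegral.continuous_parametric_intervalIntegral_of_continuous
    (f := fun (z : ℂ) (s : ℝ) => (s : ℂ) ^ n * f (s * z)) (by fun_prop) continuous_const

lemma norm_radialMean_le (n : ℕ) {f : ℂ → ℂ} {C : ℝ} (hf : ∀ z, ‖f z‖ ≤ C) (z : ℂ) :
    ‖radialMean n f z‖ ≤ C := by
  have := intervalIntegral.norm_integral_le_of_norm_le_const (a := 0) (b := 1) (C := C)
    (f := fun s : ℝ => (s : ℂ) ^ n * f (s * z)) (fun s hs => by
      rw [Set.uIoc_of_le zero_le_one] at hs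
      rw [norm_mul, norm_pow, Complex.norm_real, Real.norm_of_nonneg hs.1.le]
      have h0 : 0 ≤ C := (norm_nonneg _).trans (hf 0)
      calc s ^ n * ‖f (s * z)‖ ≤ 1 * C :=
            mul_le_mul (pow_le_one₀ hs.1.le hs.2) (hf _) (norm_nonneg _) zero_le_one
        _ = C := one_mul C)
  simpa [radialMean] using this

lemma exists_primitive_radialMean (n : ℕ) {f : ℂ → ℂ} (hc : Continuous f)
    (hf : DifferentiableOn ℂ f (ball 0 1)) :
    ∃ P : ℂ → ℂ, ∀ z ∈ ball (0 : ℂ) 1,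
      HasDerivAt P (z ^ n * f z) z ∧ z ^ (n + 1) * radialMean n f z = P z - P 0 := by
  obtain ⟨P, hP⟩ := DifferentiableOn.isExactOn_ball
    (f := fun z => z ^ n * f z) (c := 0) (r := 1) ((differentiableOn_id.pow n).mul hf)
  refine ⟨P, fun z hz => ⟨hP z hz, ?_⟩⟩
  have key := intervalIntegral.integral_eq_sub_of_hasDerivAt (a := 0) (b := 1)
    (f := fun s : ℝ => P (s * z)) (f' := fun s : ℝ => ((s * z) ^ n * f (s * z)) * z)
    (fun s hs => by
      rw [Set.uIcc_of_le zero_le_one] at hs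
      have hsz : (s : ℂ) * z ∈ ball (0 : ℂ) 1 := by
        rw [mem_ball_zero_iff] at hz ⊢
        rw [norm_mul, Complex.norm_real, Real.norm_of_nonneg hs.1]
        exact (mul_le_of_le_one_left (norm_nonneg z) hs.2).trans_lt hz
      have h1 : HasDerivAt (fun s : ℝ => (s : ℂ) * z) z s := by
        simpa using (Complex.ofRealCLM.hasDerivAt (x := s)).mul_const z
      exact (hP _ hsz).comp s h1)
    (Continuous.intervalIntegrable (by fun_prop) _ _)
  simp only [Complex.ofReal_one, one_mul, Complex.ofReal_zero, zero_mul] at key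
  rw [← key, radialMean, ← intervalIntegral.integral_const_mul]
  congr 1
  ext s
  ring

lemma hasDerivAt_pow_mul_radialMean (n : ℕ) {f : ℂ → ℂ} (hc : Continuous f)
    (hf : DifferentiableOn ℂ f (ball 0 1)) {z : ℂ} (hz : z ∈ ball (0 : ℂ) 1) :
    HasDerivAt (fun x => x ^ (n + 1) * radialMean n f x) (z ^ n * f z) z := by
  obtain ⟨P, hP⟩ := exists_primitive_radialMean n hc hf
  refine ((hP z hz).1.sub_const (P 0)).congr_of_eventuallyEq ?_
  filter_upwards [isOpen_ball.mem_nhds hz] with x hx using (hP x hx).2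

lemma differentiableOn_radialMean (n : ℕ) {f : ℂ → ℂ} (hc : Continuous f)
    (hf : DifferentiableOn ℂ f (ball 0 1)) :
    DifferentiableOn ℂ (radialMean n f) (ball 0 1) := by
  rw [← Complex.differentiableOn_compl_singleton_and_continuousAt_iff
    (ball_mem_nhds (0 : ℂ) one_pos)]
  refine ⟨fun z hz => ?_, (continuous_radialMean n hc).continuousAt⟩
  have hz0 : z ≠ 0 := hz.2
  have h := (hasDerivAt_pow_mul_radialMean n hc hf hz.1).differentiableAt.div
    ((differentiableAt_id (x := z)).pow (n + 1)) (by simpa using hz0)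
  refine (h.congr_of_eventuallyEq ?_).differentiableWithinAt
  filter_upwards [isOpen_ne.mem_nhds hz0] with x hx
  have hx' : x ≠ 0 := hx
  simp [hx']

/-- `radialMean` as a continuous linear operator on the disc algebra. -/
noncomputable def radialMeanCLM (n : ℕ) : discAlgebra →L[ℂ] discAlgebra :=
  LinearMap.mkContinuous
    { toFun := fun f => ⟨BoundedContinuousFunction.ofNormedAddCommGroup (radialMean n f.1)
        (continuous_radialMean n f.1.continuous) ‖f.1‖
        (norm_radialMean_le n f.1.norm_coe_le_norm),
        differentiableOn_radialMean n f.1.continuous f.2⟩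
      map_add' := fun f g => by
        ext z
        have hf := f.1.continuous
        have hg := g.1.continuous
        change (∫ s in (0 : ℝ)..1, (s : ℂ) ^ n * (f.1 (s * z) + g.1 (s * z))) =
          (∫ s in (0 : ℝ)..1, (s : ℂ) ^ n * f.1 (s * z)) +
            ∫ s in (0 : ℝ)..1, (s : ℂ) ^ n * g.1 (s * z)
        rw [← intervalIntegral.integral_add (Continuous.intervalIntegrable (by fun_prop) _ _)
          (Continuous.intervalIntegrable (by fun_prop) _ _)]
        simp only [mul_add]
      map_smul' := fun c f => by
        ext z
        change (∫ s in (0 : ℝ)..1, (s : ℂ) ^ n * (c * f.1 (s * z))) =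
          c * ∫ s in (0 : ℝ)..1, (s : ℂ) ^ n * f.1 (s * z)
        rw [← intervalIntegral.integral_const_mul]
        congr 1
        ext s
        ring } 1
    (fun f => by
      rw [one_mul]
      exact BoundedContinuousFunction.norm_ofNormedAddCommGroup_le _ (norm_nonneg _)
        (norm_radialMean_le n f.1.norm_coe_le_norm))

lemma radialMeanCLM_apply (n : ℕ) (f : discAlgebra) (z : ℂ) :
    (radialMeanCLM n f).1 z = radialMean n f.1 z := rfl

/-- For small `ε` the equation `x = x₀ + ε Ψ(ε, x)` is solvable. -/
lemma exists_small_fixedPoint {E : Type*} [NormedAddCommGroup E] [NormedSpace ℂ E]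
    [CompleteSpace E] {Ψ : ℂ × E → E} (hΨ : ContDiff ℂ 1 Ψ) (x₀ : E) :
    ∃ ε : ℂ, ε ≠ 0 ∧ ∃ x : E, x = x₀ + ε • Ψ (ε, x) := by
  let f : ℂ × E → ℂ × E := fun y => (y.1, y.2 - (x₀ + y.1 • Ψ y))
  have hΨ' := (hΨ.contDiffAt (x := ((0 : ℂ), x₀))).hasStrictFDerivAt one_ne_zero
  have hf : HasStrictFDerivAt f _ ((0 : ℂ), x₀) :=
    (hasStrictFDerivAt_fst (𝕜 := ℂ)).prodMk ((hasStrictFDerivAt_snd (𝕜 := ℂ)).sub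
      (((hasStrictFDerivAt_fst (𝕜 := ℂ)).smul hΨ').const_add x₀))
  have hmap := hf.map_nhds_eq_of_surj (by
    rw [LinearMap.range_eq_top]
    rintro ⟨a, b⟩
    exact ⟨(a, b + a • Ψ ((0 : ℂ), x₀)), by simp⟩)
  have hf0 : f ((0 : ℂ), x₀) = ((0 : ℂ), (0 : E)) := by simp [f]
  rw [hf0] at hmap
  have hev : ∀ᶠ y in 𝓝 ((0 : ℂ), (0 : E)), ∃ x, f x = y := by
    rw [← hmap, Filter.eventually_map]
    exact Filter.Eventually.of_forall fun x => ⟨x, rfl⟩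
  have hcont : Filter.Tendsto (fun ε : ℂ => (ε, (0 : E))) (𝓝[≠] 0) (𝓝 ((0 : ℂ), (0 : E))) :=
    (Continuous.tendsto (by fun_prop : Continuous fun ε : ℂ => (ε, (0 : E))) 0).mono_left
      nhdsWithin_le_nhds
  obtain ⟨ε, ⟨⟨ε', x⟩, hx⟩, hε⟩ := ((hcont.eventually hev).and self_mem_nhdsWithin).exists
  simp only [f, Prod.mk.injEq] at hx
  obtain ⟨rfl, hx⟩ := hx
  exact ⟨ε', hε, x, sub_eq_zero.1 hx⟩

/-- Solvability of the regularised system obtained from `P_VI` by `q = a + z V`, `p = z U`. -/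
lemma exists_regularised_solution {k κ₃ a u₀ v₀ : ℂ} (ha : a * k = 1)
    (hv₀ : -2 * v₀ = κ₃ * a + 2 * a ^ 2 * (a - 1) * u₀) :
    ∃ r : ℝ, 0 < r ∧ ∃ U V : ℂ → ℂ,
      DifferentiableOn ℂ U (ball 0 r) ∧ DifferentiableOn ℂ V (ball 0 r) ∧ U 0 = u₀ ∧ V 0 = v₀ ∧
      ∀ z ∈ ball (0 : ℂ) r, z ≠ 0 →
        (1 - z) * deriv U z =
          (3 * (a + z * V z) ^ 2 - 2 * (1 + z) * (a + z * V z) + z) * U z ^ 2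
            + (2 * k * V z + κ₃ + 1) * U z ∧
        (z - 1) * (z * deriv V z + V z) =
          2 * (a + z * V z) * (a + z * V z - 1) * (a + z * V z - z) * U z
            + (a + z * V z) * (k * V z + κ₃) := by
  let c : ℂ → discAlgebra := algebraMap ℂ discAlgebra
  let H : ℂ × (discAlgebra × discAlgebra) → discAlgebra := fun y =>
    (c 3 * (c a + (y.1 • discCoord) * y.2.2) ^ 2
      - c 2 * (1 + y.1 • discCoord) * (c a + (y.1 • discCoord) * y.2.2)
      + y.1 • discCoord) * y.2.1 ^ 2 + (c (2 * k) * y.2.2 + c κ₃) * y.2.1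
  let W : ℂ × (discAlgebra × discAlgebra) → discAlgebra := fun y =>
    y.2.1 + radialMeanCLM 0 (H y)
  let P : ℂ × (discAlgebra × discAlgebra) → discAlgebra := fun y =>
    c (2 * a - 1) * y.2.2 + (y.1 • discCoord) * y.2.2 ^ 2
  let G : ℂ × (discAlgebra × discAlgebra) → discAlgebra := fun y =>
    c 2 * y.2.2 + c (2 * a ^ 2 * (a - 1)) * W y
      + c 2 * (c a * P y + c (a * (a - 1)) * (y.2.2 - 1)
          + (y.1 • discCoord) * P y * (y.2.2 - 1)) * y.2.1
      + y.2.2 * (c k * y.2.2 + c κ₃)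
  have hH : ContDiff ℂ 1 H := by fun_prop
  have hW : ContDiff ℂ 1 W := by fun_prop
  have hP : ContDiff ℂ 1 P := by fun_prop
  have hG : ContDiff ℂ 1 G := by fun_prop
  have hΨ : ContDiff ℂ 1 fun y : ℂ × (discAlgebra × discAlgebra) =>
      (discCoord * W y, discCoord * (y.2.2 - radialMeanCLM 2 (G y))) := by fun_prop
  obtain ⟨ε, hε, ⟨u, v⟩, hx⟩ := exists_small_fixedPoint hΨ (c u₀, c v₀)
  simp only [Prod.smul_mk, Prod.mk_add_mk, Prod.mk.injEq] at hx
  obtain ⟨hu, hv⟩ := hx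
  set y : ℂ × (discAlgebra × discAlgebra) := (ε, u, v)
  have hu_eq : ∀ x ∈ ball (0 : ℂ) 1,
      (1 - ε * x) * u.1 x = u₀ + ε * (x ^ (0 + 1) * radialMean 0 (H y).1 x) := by
    intro x hx
    have h : u.1 x = u₀ + ε * (discCoord.1 x * (u.1 x + radialMean 0 (H y).1 x)) :=
      congrArg (fun f : discAlgebra => f.1 x) hu
    rw [discCoord_apply hx] at h
    linear_combination h
  have hv_eq : ∀ x ∈ ball (0 : ℂ) 1,
      (1 - ε * x) * v.1 x = v₀ - ε * (x * radialMean 2 (G y).1 x) := by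
    intro x hx
    have h : v.1 x = v₀ + ε * (discCoord.1 x * (v.1 x - radialMean 2 (G y).1 x)) :=
      congrArg (fun f : discAlgebra => f.1 x) hv
    rw [discCoord_apply hx] at h
    linear_combination h
  have hH_eq : ∀ x ∈ ball (0 : ℂ) 1, (H y).1 x =
      (3 * (a + ε * x * v.1 x) ^ 2 - 2 * (1 + ε * x) * (a + ε * x * v.1 x) + ε * x) * u.1 x ^ 2
        + (2 * k * v.1 x + κ₃) * u.1 x := by
    intro x hx
    have h : (H y).1 x =
      (3 * (a + ε * discCoord.1 x * v.1 x) ^ 2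
        - 2 * (1 + ε * discCoord.1 x) * (a + ε * discCoord.1 x * v.1 x)
        + ε * discCoord.1 x) * u.1 x ^ 2 + (2 * k * v.1 x + κ₃) * u.1 x := rfl
    rwa [discCoord_apply hx] at h
  have hG_eq : ∀ x ∈ ball (0 : ℂ) 1, (G y).1 x =
      2 * v.1 x + 2 * a ^ 2 * (a - 1) * (u.1 x + radialMean 0 (H y).1 x)
        + 2 * (a * ((2 * a - 1) * v.1 x + ε * x * v.1 x ^ 2) + a * (a - 1) * (v.1 x - 1)
          + ε * x * ((2 * a - 1) * v.1 x + ε * x * v.1 x ^ 2) * (v.1 x - 1)) * u.1 x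
        + v.1 x * (k * v.1 x + κ₃) := by
    intro x hx
    have h : (G y).1 x =
      2 * v.1 x + 2 * a ^ 2 * (a - 1) * (u.1 x + radialMean 0 (H y).1 x)
        + 2 * (a * ((2 * a - 1) * v.1 x + ε * discCoord.1 x * v.1 x ^ 2)
          + a * (a - 1) * (v.1 x - 1)
          + ε * discCoord.1 x * ((2 * a - 1) * v.1 x + ε * discCoord.1 x * v.1 x ^ 2)
            * (v.1 x - 1)) * u.1 x
        + v.1 x * (k * v.1 x + κ₃) := rfl
    rwa [discCoord_apply hx] at h
  clear_value y H G
  have hmaps : Set.MapsTo (fun z : ℂ => ε⁻¹ * z) (ball 0 ‖ε‖) (ball 0 1) := by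
    intro z hz
    rw [mem_ball_zero_iff] at hz ⊢
    rw [norm_mul, norm_inv, inv_mul_lt_iff₀ (norm_pos_iff.2 hε), mul_one]
    exact hz
  have hlin : DifferentiableOn ℂ (fun z : ℂ => ε⁻¹ * z) (ball 0 ‖ε‖) := by fun_prop
  have h0 : (0 : ℂ) ∈ ball (0 : ℂ) 1 := mem_ball_self one_pos
  refine ⟨‖ε‖, norm_pos_iff.2 hε, fun z => u.1 (ε⁻¹ * z), fun z => v.1 (ε⁻¹ * z),
    (discAlgebra_differentiableOn u).comp hlin hmaps,
    (discAlgebra_differentiableOn v).comp hlin hmaps, by simpa using hu_eq 0 h0,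
    by simpa using hv_eq 0 h0, fun z hz hz0 => ?_⟩
  obtain ⟨x, rfl⟩ : ∃ x, z = ε * x := ⟨ε⁻¹ * z, by field_simp⟩
  have hx : x ∈ ball (0 : ℂ) 1 := by simpa [hε] using hmaps hz
  have hx0 : x ≠ 0 := right_ne_zero_of_mul hz0
  have hxε : ε⁻¹ * (ε * x) = x := by field_simp
  have hnhds := isOpen_ball.mem_nhds hx
  have hud := ((discAlgebra_differentiableOn u).differentiableAt hnhds).hasDerivAt
  have hvd := ((discAlgebra_differentiableOn v).differentiableAt hnhds).hasDerivAt
  have hscale : HasDerivAt (fun z : ℂ => ε⁻¹ * z) ε⁻¹ (ε * x) := by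
    simpa using (hasDerivAt_id (ε * x)).const_mul ε⁻¹
  have hUd : deriv (fun z => u.1 (ε⁻¹ * z)) (ε * x) = deriv u.1 x * ε⁻¹ :=
    (HasDerivAt.comp (h₂ := u.1) (ε * x) (by rwa [hxε]) hscale).deriv
  have hVd : deriv (fun z => v.1 (ε⁻¹ * z)) (ε * x) = deriv v.1 x * ε⁻¹ :=
    (HasDerivAt.comp (h₂ := v.1) (ε * x) (by rwa [hxε]) hscale).deriv
  have hone : HasDerivAt (fun x : ℂ => 1 - ε * x) (-ε) x := by
    simpa using ((hasDerivAt_id x).const_mul ε).const_sub 1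
  have hsq : HasDerivAt (fun x : ℂ => x ^ 2) (2 * x) x := by simpa using hasDerivAt_pow 2 x
  have du : -ε * u.1 x + (1 - ε * x) * deriv u.1 x = ε * (H y).1 x := by
    have h2 := ((hasDerivAt_pow_mul_radialMean 0 (H y).1.continuous (H y).2 hx).const_mul
      ε).const_add u₀
    have h1 := h2.congr_of_eventuallyEq (f₁ := (fun x => 1 - ε * x) * (u.1 : ℂ → ℂ))
      (by filter_upwards [hnhds] with s hs using hu_eq s hs)
    simpa using (hone.mul hud).unique h1
  have dv : -ε * (x ^ 2 * v.1 x) + (1 - ε * x) * (2 * x * v.1 x + x ^ 2 * deriv v.1 x)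
      = v₀ * (2 * x) - ε * (x ^ 2 * (G y).1 x) := by
    have h2 := (hsq.const_mul v₀).sub
      ((hasDerivAt_pow_mul_radialMean 2 (G y).1.continuous (G y).2 hx).const_mul ε)
    have h1 := h2.congr_of_eventuallyEq (f₁ := (fun x => 1 - ε * x) * ((fun x => x ^ 2) * (v.1 : ℂ → ℂ)))
      (by
        filter_upwards [hnhds] with s hs
        simp only [Pi.sub_apply, Pi.mul_apply]
        linear_combination s ^ 2 * hv_eq s hs)
    exact (hone.mul (hsq.mul hvd)).unique h1
  have dv' : -ε * (x * v.1 x) + (1 - ε * x) * (2 * v.1 x + x * deriv v.1 x)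
      = 2 * v₀ - ε * (x * (G y).1 x) :=
    mul_left_cancel₀ hx0 (by linear_combination dv)
  have hw := hu_eq x hx
  simp only [hUd, hVd, hxε]
  rw [hH_eq x hx] at du
  rw [hG_eq x hx] at dv'
  constructor
  · have : (1 - ε * x) * (deriv u.1 x * ε⁻¹) = ε⁻¹ * ((1 - ε * x) * deriv u.1 x) := by ring
    rw [this, inv_mul_eq_iff_eq_mul₀ hε]
    linear_combination du
  · have : ε * x * (deriv v.1 x * ε⁻¹) = x * deriv v.1 x := by field_simp
    rw [this]
    linear_combination -dv' - v.1 x * ha + hv₀ - 2 * a ^ 2 * (a - 1) * hw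

/-- A function with a double zero at the origin is `z ^ 2` times a holomorphic function. -/
lemma exists_eq_sq_mul {f : ℂ → ℂ} {r : ℝ} (hr : 0 < r) (hf : DifferentiableOn ℂ f (ball 0 r))
    (h0 : f 0 = 0) (h1 : deriv f 0 = 0) :
    ∃ h : ℂ → ℂ, DifferentiableOn ℂ h (ball 0 r) ∧ ∀ z, f z = z ^ 2 * h z := by
  have hn := ball_mem_nhds (0 : ℂ) hr
  refine ⟨dslope (dslope f 0) 0, ?_, fun z => ?_⟩
  · rwa [Complex.differentiableOn_dslope hn, Complex.differentiableOn_dslope hn]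
  · have e1 := sub_smul_dslope f 0 z
    have e2 := sub_smul_dslope (dslope f 0) 0 z
    rw [dslope_same, h1] at e2
    simp only [sub_zero, smul_eq_mul, h0] at e1 e2
    rw [← e1, ← e2]
    ring

/-- The holomorphic extension of `z / (1 - (1 - z) ^ k)` across the origin. -/
lemma exists_riccati_germ {k : ℂ} (hk : k ≠ 0) :
    ∃ r : ℝ, 0 < r ∧ r < 1 ∧ ∃ R : ℂ → ℂ, DifferentiableOn ℂ R (ball 0 r) ∧ R 0 = 1 / k ∧
      deriv R 0 = (k - 1) / (2 * k) ∧
      ∀ z ∈ ball (0 : ℂ) r, z ≠ 0 → R z = z / (1 - (1 - z) ^ k) := by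
  have hslit : ∀ z ∈ ball (0 : ℂ) 1, 1 - z ∈ Complex.slitPlane := fun z hz => by
    refine Complex.mem_slitPlane_of_norm_lt_one (z := -z) ?_
    simpa using hz
  have hpow : ∀ (l : ℂ), ∀ z ∈ ball (0 : ℂ) 1,
      HasDerivAt (fun z : ℂ => (1 - z) ^ l) (-(l * (1 - z) ^ (l - 1))) z := fun l z hz => by
    simpa using ((hasDerivAt_id z).const_sub 1).cpow_const (c := l) (hslit z hz)
  set g : ℂ → ℂ := fun z => 1 - (1 - z) ^ k with hg
  have hgd : ∀ z ∈ ball (0 : ℂ) 1, HasDerivAt g (k * (1 - z) ^ (k - 1)) z := fun z hz => by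
    simpa using (hpow k z hz).const_sub 1
  have h0 : (0 : ℂ) ∈ ball (0 : ℂ) 1 := mem_ball_self one_pos
  have hn := ball_mem_nhds (0 : ℂ) one_pos
  set D := dslope g 0 with hD
  have hDd : DifferentiableOn ℂ D (ball 0 1) := by
    rw [hD, Complex.differentiableOn_dslope hn]
    exact fun z hz => (hgd z hz).differentiableAt.differentiableWithinAt
  have hD0 : D 0 = k := by
    rw [hD, dslope_same, (hgd 0 h0).deriv]
    simp
  have hzD : ∀ z, z * D z = g z := fun z => by
    have := sub_smul_dslope g 0 z
    simpa [hg] using this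
  have hDat : ∀ z ∈ ball (0 : ℂ) 1, HasDerivAt D (deriv D z) z := fun z hz =>
    (hDd.differentiableAt (isOpen_ball.mem_nhds hz)).hasDerivAt
  have hsum : ∀ z ∈ ball (0 : ℂ) 1, D z + z * deriv D z = k * (1 - z) ^ (k - 1) := fun z hz => by
    have h1 := (hasDerivAt_id z).mul (hDat z hz)
    have h2 : HasDerivAt (id * D) (k * (1 - z) ^ (k - 1)) z := by
      have : id * D = g := funext hzD
      rw [this]
      exact hgd z hz
    simpa using h1.unique h2
  have hD' : deriv D 0 = -(k * (k - 1)) / 2 := by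
    have h1 : HasDerivAt (deriv D) (deriv (deriv D) 0) 0 :=
      ((hDd.deriv isOpen_ball).differentiableAt hn).hasDerivAt
    have h2 := (hDat 0 h0).add ((hasDerivAt_id (0 : ℂ)).mul h1)
    have h3 := ((hpow (k - 1) 0 h0).const_mul k).congr_of_eventuallyEq (f₁ := D + id * deriv D)
      (by filter_upwards [hn] with z hz using hsum z hz)
    have h4 := h2.unique h3
    simp at h4
    linear_combination h4 / 2
  have hne : ∀ᶠ z in 𝓝 (0 : ℂ), D z ≠ 0 :=
    (hDat 0 h0).continuousAt.eventually_ne (by rwa [hD0])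
  obtain ⟨ρ, hρ, hball⟩ := Metric.eventually_nhds_iff_ball.1 hne
  have hsub1 : ball (0 : ℂ) (min ρ (1 / 2)) ⊆ ball 0 ρ := ball_subset_ball (min_le_left _ _)
  have hsub2 : ball (0 : ℂ) (min ρ (1 / 2)) ⊆ ball 0 1 :=
    ball_subset_ball ((min_le_right _ _).trans (by norm_num))
  refine ⟨min ρ (1 / 2), by positivity, (min_le_right _ _).trans_lt (by norm_num),
    fun z => (D z)⁻¹, (hDd.mono hsub2).inv fun z hz => hball z (hsub1 hz), by simp [hD0], ?_,
    fun z hz hz0 => ?_⟩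
  · have := ((hDat 0 h0).inv (by rwa [hD0])).deriv
    rw [hD0, hD'] at this
    refine this.trans ?_
    field_simp
  · have hDz := hball z (hsub1 hz)
    change (D z)⁻¹ = z / g z
    rw [← hzD z]
    field_simp

/-- On the stratum `A₃` (i.e. `κ₀ = κ₁ = κ₂ = 0`, `κ₃ + κ₄ = 1`, `κ₄ ≠ 0`),
Painlevé VI admits a `1`-parameter family of holomorphic solution germs at `z = 0` with
`q(z) = R(z) + tκ₃ z + O(z²)`, where `R` is the analytic extension of
`z/(1 − (1−z)^{κ₄})` with `R(0) = 1/κ₄`, and `p(0) = 0`, `p′(0) = −tκ₄³`. -/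
theorem holomorphic_solution_family_A3
    (κ₀ κ₁ κ₂ κ₃ κ₄ : ℂ) (h₀ : κ₀ = 0) (h₁ : κ₁ = 0) (h₂ : κ₂ = 0)
    (h₃₄ : κ₃ + κ₄ = 1) (hκ₄ : κ₄ ≠ 0) (t : ℂ) :
    ∃ (r : ℝ) (q p R h : ℂ → ℂ), 0 < r ∧ r < 1 ∧
      (∀ z ∈ Metric.ball (0 : ℂ) r, AnalyticAt ℂ q z) ∧
      (∀ z ∈ Metric.ball (0 : ℂ) r, AnalyticAt ℂ p z) ∧
      (∀ z ∈ Metric.ball (0 : ℂ) r, AnalyticAt ℂ R z) ∧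
      (∀ z ∈ Metric.ball (0 : ℂ) r, AnalyticAt ℂ h z) ∧
      R 0 = 1 / κ₄ ∧
      (∀ z ∈ Metric.ball (0 : ℂ) r, z ≠ 0 → R z = z / (1 - (1 - z) ^ κ₄)) ∧
      (∀ z ∈ Metric.ball (0 : ℂ) r, q z = R z + t * κ₃ * z + z ^ 2 * h z) ∧
      p 0 = 0 ∧ deriv p 0 = -t * κ₄ ^ 3 ∧
      ∀ z ∈ Metric.ball (0 : ℂ) r, z ≠ 0 → SolvesPVIAt κ₀ κ₁ κ₂ κ₃ κ₄ q p z := by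
  subst h₀ h₁ h₂
  obtain ⟨ρ, hρ, U, V, hU, hV, hU0, hV0, hode⟩ := exists_regularised_solution (k := κ₄)
    (κ₃ := κ₃) (a := 1 / κ₄) (u₀ := -t * κ₄ ^ 3) (v₀ := -κ₃ / (2 * κ₄) + t * κ₃)
    (by field_simp) (by
      obtain rfl : κ₃ = 1 - κ₄ := eq_sub_of_add_eq h₃₄
      field_simp
      ring)
  obtain ⟨ρ', hρ', hρ'1, R, hR, hR0, hR1, hReq⟩ := exists_riccati_germ hκ₄
  have hr : 0 < min ρ ρ' := lt_min hρ hρ'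
  have hs : ball (0 : ℂ) (min ρ ρ') ⊆ ball 0 ρ := ball_subset_ball (min_le_left _ _)
  have hs' : ball (0 : ℂ) (min ρ ρ') ⊆ ball 0 ρ' := ball_subset_ball (min_le_right _ _)
  replace hU := hU.mono hs
  replace hV := hV.mono hs
  replace hR := hR.mono hs'
  have hq : DifferentiableOn ℂ (fun z => 1 / κ₄ + z * V z) (ball 0 (min ρ ρ')) :=
    (differentiableOn_const _).add (differentiableOn_id.mul hV)
  have hp : DifferentiableOn ℂ (fun z => z * U z) (ball 0 (min ρ ρ')) :=
    differentiableOn_id.mul hU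
  have hUat : ∀ z ∈ ball (0 : ℂ) (min ρ ρ'), HasDerivAt U (deriv U z) z := fun z hz =>
    (hU.differentiableAt (isOpen_ball.mem_nhds hz)).hasDerivAt
  have hVat : ∀ z ∈ ball (0 : ℂ) (min ρ ρ'), HasDerivAt V (deriv V z) z := fun z hz =>
    (hV.differentiableAt (isOpen_ball.mem_nhds hz)).hasDerivAt
  have hqd : ∀ z ∈ ball (0 : ℂ) (min ρ ρ'),
      HasDerivAt (fun z => 1 / κ₄ + z * V z) (V z + z * deriv V z) z := fun z hz => by
    simpa using ((hasDerivAt_id z).mul (hVat z hz)).const_add (1 / κ₄)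
  have hpd : ∀ z ∈ ball (0 : ℂ) (min ρ ρ'),
      HasDerivAt (fun z => z * U z) (U z + z * deriv U z) z := fun z hz => by
    simpa using (hasDerivAt_id' z).fun_mul (hUat z hz)
  have h0 : (0 : ℂ) ∈ ball (0 : ℂ) (min ρ ρ') := mem_ball_self hr
  obtain ⟨h, hh, hheq⟩ := exists_eq_sq_mul hr
    (f := fun z => 1 / κ₄ + z * V z - R z - t * κ₃ * z)
    ((hq.sub hR).sub (by fun_prop)) (by simp [hR0]) (by
      have h1 := (((hqd 0 h0).sub
        (hR.differentiableAt (isOpen_ball.mem_nhds h0)).hasDerivAt).sub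
        ((hasDerivAt_id (0 : ℂ)).const_mul (t * κ₃))).deriv
      refine h1.trans ?_
      rw [hV0, hR1]
      obtain rfl : κ₃ = 1 - κ₄ := eq_sub_of_add_eq h₃₄
      field_simp
      ring)
  refine ⟨min ρ ρ', fun z => 1 / κ₄ + z * V z, fun z => z * U z, R, h, hr,
    (min_le_right _ _).trans_lt hρ'1, fun z hz => hq.analyticAt (isOpen_ball.mem_nhds hz),
    fun z hz => hp.analyticAt (isOpen_ball.mem_nhds hz),
    fun z hz => hR.analyticAt (isOpen_ball.mem_nhds hz),
    fun z hz => hh.analyticAt (isOpen_ball.mem_nhds hz), hR0,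
    fun z hz => hReq z (hs' hz), fun z _ => by linear_combination hheq z, by simp,
    by simp [(hpd 0 h0).deriv, hU0], fun z hz hz0 => ?_⟩
  obtain ⟨e1, e2⟩ := hode z (hs hz) hz0
  have ha : 1 / κ₄ * κ₄ = 1 := by field_simp
  obtain rfl : κ₃ = 1 - κ₄ := eq_sub_of_add_eq h₃₄
  simp only [SolvesPVIAt, (hqd z hz).deriv, (hpd z hz).deriv]
  generalize 1 / κ₄ = a at *
  constructor
  · linear_combination z * e2 - (a + z * V z) * ha
  · linear_combination -z ^ 2 * e1 + 2 * z * U z * ha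
end

section
/- Let κ = (κ₀,κ₁,κ₂,κ₃,κ₄) ∈ ℂ⁵ with κ₀ = κ₁ = κ₂ = κ₃ = 0 and κ₄ = 1. Then for every t ∈ ℂ there exist r ∈ (0,1) and functions q, p : ℂ → ℂ such that: (i) q is analytic on {z : |z| < r} with q(0) = 1 and q′(0) = t; (ii) the function z ↦ p(z) − z/((1−z)·log(1−z)) (with the principal branch of the complex logarithm, so that z/((1−z)log(1−z)) has a removable singularity at z = 0 with value −1) extends analytically to {z : |z| < r}, vanishes at z = 0, and has derivative t at z = 0; (iii) (q,p) solves P_VI(κ) at every z with 0 < |z| < r. -/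
section
open Filter Topology Metric

/-- A holomorphic version of the contraction principle: an operator on the holomorphic functions
`U → closedBall c δ` that halves uniform distances has a fixed point. -/
theorem exists_fixedPoint_of_holomorphic_contraction {E : Type*} [NormedAddCommGroup E]
    [NormedSpace ℂ E] [CompleteSpace E] {U : Set ℂ} (hU : IsOpen U) {c : E} {δ : ℝ} (hδ : 0 ≤ δ)
    (T : (ℂ → E) → ℂ → E)
    (hd : ∀ u, DifferentiableOn ℂ u U → Set.MapsTo u U (closedBall c δ) →
      DifferentiableOn ℂ (T u) U ∧ Set.MapsTo (T u) U (closedBall c δ))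
    (hT : ∀ u v, DifferentiableOn ℂ u U → Set.MapsTo u U (closedBall c δ) →
      DifferentiableOn ℂ v U → Set.MapsTo v U (closedBall c δ) →
      ∀ C, (∀ z ∈ U, dist (u z) (v z) ≤ C) → ∀ z ∈ U, dist (T u z) (T v z) ≤ C / 2) :
    ∃ u, DifferentiableOn ℂ u U ∧ Set.MapsTo u U (closedBall c δ) ∧ ∀ z ∈ U, T u z = u z := by
  set w : ℕ → ℂ → E := fun n => T^[n] fun _ => c with hw
  have hsucc (n : ℕ) : w (n + 1) = T (w n) := Function.iterate_succ_apply' T n _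
  have hmem (n : ℕ) : DifferentiableOn ℂ (w n) U ∧ Set.MapsTo (w n) U (closedBall c δ) := by
    induction n with
    | zero => exact ⟨differentiableOn_const c, fun z _ => mem_closedBall_self hδ⟩
    | succ n ih => rw [hsucc]; exact hd _ ih.1 ih.2
  have hdist (n : ℕ) : ∀ z ∈ U, dist (w n z) (w (n + 1) z) ≤ 2 * δ / 2 / 2 ^ n := by
    induction n with
    | zero =>
      intro z hz
      have h := (hmem 1).2 hz
      rw [mem_closedBall'] at h
      simpa [hw] using h
    | succ n ih =>
      intro z hz
      rw [hsucc (n + 1)]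
      nth_rewrite 1 [hsucc n]
      refine (hT _ _ (hmem n).1 (hmem n).2 (hmem _).1 (hmem _).2 _ ih z hz).trans_eq ?_
      rw [pow_succ]; ring
  have hlim : ∀ z, ∃ a, z ∈ U → Tendsto (fun n => w n z) atTop (𝓝 a) := by
    intro z
    by_cases hz : z ∈ U
    · obtain ⟨a, ha⟩ := cauchySeq_tendsto_of_complete
        (cauchySeq_of_le_geometric_two fun n => hdist n z hz)
      exact ⟨a, fun _ => ha⟩
    · exact ⟨0, fun h => absurd h hz⟩
  choose u hu using hlim
  have hbound (n : ℕ) (z : ℂ) (hz : z ∈ U) : dist (w n z) (u z) ≤ 2 * δ / 2 ^ n :=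
    dist_le_of_le_geometric_two_of_tendsto (fun n => hdist n z hz) (hu z hz) n
  have hzero : Tendsto (fun n : ℕ => 2 * δ / 2 ^ n) atTop (𝓝 0) :=
    tendsto_const_nhds.div_atTop (tendsto_pow_atTop_atTop_of_one_lt one_lt_two)
  have hunif : TendstoUniformlyOn w u atTop U := by
    rw [Metric.tendstoUniformlyOn_iff]
    intro ε hε
    filter_upwards [hzero.eventually (gt_mem_nhds hε)] with n hn z hz
    rw [dist_comm]
    exact (hbound n z hz).trans_lt hn
  have hud : DifferentiableOn ℂ u U := hunif.tendstoLocallyUniformlyOn.differentiableOn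
    (Eventually.of_forall fun n => (hmem n).1) hU
  have hum : Set.MapsTo u U (closedBall c δ) := fun z hz =>
    isClosed_closedBall.mem_of_tendsto (hu z hz) (Eventually.of_forall fun n => (hmem n).2 hz)
  refine ⟨u, hud, hum, fun z hz => ?_⟩
  refine tendsto_nhds_unique ?_ ((tendsto_add_atTop_iff_nat 1).2 (hu z hz))
  rw [tendsto_iff_dist_tendsto_zero]
  refine squeeze_zero (fun _ => dist_nonneg) (fun n => ?_)
    (by simpa using hzero.div_const 2)
  rw [hsucc]
  exact hT _ _ (hmem n).1 (hmem n).2 hud hum _ (hbound n) z hz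

/-- If `(z ^ m * w)' = z ^ m * g` and `w 0 = 0`, a bound on `g` gives a bound on `w`. -/
theorem norm_le_of_hasDerivAt_pow_mul {m : ℕ} {r C : ℝ} {g w : ℂ → ℂ} (hw0 : w 0 = 0)
    (hw : ∀ z ∈ ball (0 : ℂ) r, HasDerivAt (fun z => z ^ m * w z) (z ^ m * g z) z)
    (hg : ∀ z ∈ ball (0 : ℂ) r, ‖g z‖ ≤ C) {z : ℂ} (hz : z ∈ ball (0 : ℂ) r) :
    ‖w z‖ ≤ C * ‖z‖ := by
  rcases eq_or_ne z 0 with rfl | hne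
  · simp [hw0]
  have hsub : ∀ ζ ∈ closedBall (0 : ℂ) ‖z‖, ζ ∈ ball (0 : ℂ) r := fun ζ hζ => by
    rw [mem_closedBall_zero_iff] at hζ
    rw [mem_ball_zero_iff] at hz ⊢
    exact hζ.trans_lt hz
  have key := (convex_closedBall (0 : ℂ) ‖z‖).norm_image_sub_le_of_norm_hasDerivWithin_le
    (f := fun z => z ^ m * w z) (C := ‖z‖ ^ m * C)
    (fun ζ hζ => (hw ζ (hsub ζ hζ)).hasDerivWithinAt)
    (fun ζ hζ => by
      rw [norm_mul, norm_pow]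
      rw [mem_closedBall_zero_iff] at hζ
      gcongr
      exact hg ζ (hsub ζ (by simpa using hζ)))
    (mem_closedBall_self (norm_nonneg z)) (y := z) (by simp)
  simp only [hw0, mul_zero, sub_zero, norm_mul, norm_pow] at key
  have hpos : 0 < ‖z‖ ^ m := pow_pos (norm_pos_iff.2 hne) m
  rw [mul_assoc] at key
  exact le_of_mul_le_mul_left key hpos

/-- The equation `(z ^ m * w)' = z ^ m * g`, `w 0 = 0`, has a holomorphic solution on a disc. -/
theorem exists_hasDerivAt_pow_mul (m : ℕ) {r : ℝ} (hr : 0 < r) {g : ℂ → ℂ}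
    (hg : DifferentiableOn ℂ g (ball 0 r)) :
    ∃ w : ℂ → ℂ, DifferentiableOn ℂ w (ball 0 r) ∧ w 0 = 0 ∧
      ∀ z ∈ ball (0 : ℂ) r, HasDerivAt (fun z => z ^ m * w z) (z ^ m * g z) z := by
  have hd : DifferentiableOn ℂ (fun z => z ^ m * g z) (ball 0 r) := by fun_prop
  obtain ⟨G, hG0, hG⟩ := hd.isExactOn_ball.with_val_at 0 0
  have heq : (fun z => z ^ m * (G z / z ^ m)) = G := by
    funext z
    rcases eq_or_ne z 0 with rfl | hz
    · simp [hG0]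
    · field_simp
  have hw0 : G 0 / 0 ^ m = 0 := by simp [hG0]
  refine ⟨fun z => G z / z ^ m, ?_, hw0, fun z hz => by rw [heq]; exact hG z hz⟩
  have h0 : ball (0 : ℂ) r ∈ 𝓝 0 := ball_mem_nhds 0 hr
  rw [← Complex.differentiableOn_compl_singleton_and_continuousAt_iff h0]
  constructor
  · intro z hz
    have hz0 : z ^ m ≠ 0 := pow_ne_zero _ hz.2
    exact ((hG z hz.1).differentiableAt.div (differentiableAt_id.pow m) hz0).differentiableWithinAt
  · have hc : ContinuousAt g 0 := (hg.differentiableAt h0).continuousAt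
    obtain ⟨s, hs, hs'⟩ := Metric.eventually_nhds_iff_ball.1
      ((hc.norm.eventually (gt_mem_nhds (lt_add_one ‖g 0‖))).and h0)
    have hb : ∀ z ∈ ball (0 : ℂ) s, ‖G z / z ^ m‖ ≤ (‖g 0‖ + 1) * ‖z‖ := fun z hz =>
      norm_le_of_hasDerivAt_pow_mul (m := m) (w := fun z => G z / z ^ m) hw0
        (fun ζ hζ => by rw [heq]; exact hG ζ (hs' ζ hζ).2) (fun ζ hζ => (hs' ζ hζ).1.le) hz
    rw [ContinuousAt, hw0]
    refine squeeze_zero_norm' (Filter.eventually_of_mem (ball_mem_nhds 0 hs) hb) ?_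
    have : ContinuousAt (fun z : ℂ => (‖g 0‖ + 1) * ‖z‖) 0 := by fun_prop
    simpa [ContinuousAt] using this

/-- The Briot–Bouquet system `z X' + m (X - s) = z f(z, X, Y)`, `z Y' + n (Y - t) = z g(z, X, Y)`
has a holomorphic solution with `X 0 = s`, `Y 0 = t`. -/
theorem exists_briotBouquet_solution (m n : ℕ) (s t : ℂ) {f g : ℂ × ℂ × ℂ → ℂ}
    (hf : AnalyticAt ℂ f (0, s, t)) (hg : AnalyticAt ℂ g (0, s, t)) :
    ∃ X Y : ℂ → ℂ, AnalyticAt ℂ X 0 ∧ AnalyticAt ℂ Y 0 ∧ X 0 = s ∧ Y 0 = t ∧ ∀ᶠ z in 𝓝 0,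
      HasDerivAt (fun z => z ^ m * (X z - s)) (z ^ m * f (z, X z, Y z)) z ∧
      HasDerivAt (fun z => z ^ n * (Y z - t)) (z ^ n * g (z, X z, Y z)) z := by
  have hdist {z : ℂ} {x y : ℂ × ℂ} : dist (z, x) (z, y) = dist x y := by
    simp [Prod.dist_eq]
  obtain ⟨L, S, hS, hL⟩ := ((hf.prod hg).contDiffAt (n := 1)).exists_lipschitzOnWith
  obtain ⟨ρ, hρ, hb⟩ := Metric.eventually_nhds_iff_ball.1
    (((eventually_mem_set.2 hS).and ((hf.eventually_analyticAt).and
      (hg.eventually_analyticAt))).and ((hf.prod hg).continuousAt.norm.eventually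
        (gt_mem_nhds (lt_add_one _))))
  set M : ℝ := ‖(f (0, s, t), g (0, s, t))‖ + 1 with hM
  have hMpos : 0 < M := by positivity
  obtain ⟨r, hr, hrρ, hrM, hrL⟩ : ∃ r > 0, r < ρ ∧ M * r ≤ ρ / 2 ∧ L * r ≤ 1 / 2 := by
    have h1 : ∀ᶠ r : ℝ in 𝓝[>] 0, M * r < ρ / 2 :=
      nhdsWithin_le_nhds (ContinuousAt.eventually_lt (by fun_prop) (by fun_prop) (by simpa))
    have h2 : ∀ᶠ r : ℝ in 𝓝[>] 0, L * r < 1 / 2 :=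
      nhdsWithin_le_nhds (ContinuousAt.eventually_lt (by fun_prop) (by fun_prop) (by simp))
    have h3 : ∀ᶠ r : ℝ in 𝓝[>] 0, r < ρ := nhdsWithin_le_nhds (gt_mem_nhds hρ)
    obtain ⟨r, h0, h1, h2, h3⟩ :=
      (eventually_mem_nhdsWithin.and (h1.and (h2.and h3))).exists
    exact ⟨r, h0, h3, h1.le, h2.le⟩
  have hball {u : ℂ → ℂ × ℂ} (hu : Set.MapsTo u (ball 0 r) (closedBall (s, t) (ρ / 2))) {z : ℂ}
      (hz : z ∈ ball (0 : ℂ) r) : (z, u z) ∈ ball ((0 : ℂ), s, t) ρ := by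
    have h1 := hu hz
    rw [mem_closedBall] at h1
    rw [mem_ball] at hz ⊢
    rw [Prod.dist_eq]
    exact max_lt (hz.trans hrρ) (by simpa using h1.trans_lt (half_lt_self hρ))
  have hJ (k : ℕ) (h : ℂ → ℂ) : ∃ w : ℂ → ℂ, DifferentiableOn ℂ h (ball 0 r) →
      DifferentiableOn ℂ w (ball 0 r) ∧ w 0 = 0 ∧
      ∀ z ∈ ball (0 : ℂ) r, HasDerivAt (fun z => z ^ k * w z) (z ^ k * h z) z := by
    by_cases hh : DifferentiableOn ℂ h (ball 0 r)
    · obtain ⟨w, hw⟩ := exists_hasDerivAt_pow_mul k hr hh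
      exact ⟨w, fun _ => hw⟩
    · exact ⟨0, fun h => absurd h hh⟩
  choose J hJ using hJ
  have hcomp {e : ℂ × ℂ × ℂ → ℂ} (he : ∀ x ∈ ball ((0 : ℂ), s, t) ρ, AnalyticAt ℂ e x)
      {u : ℂ → ℂ × ℂ} (hd : DifferentiableOn ℂ u (ball 0 r))
      (hu : Set.MapsTo u (ball 0 r) (closedBall (s, t) (ρ / 2))) :
      DifferentiableOn ℂ (fun z => e (z, u z)) (ball 0 r) := fun z hz =>
    (he _ (hball hu hz)).differentiableAt.comp_differentiableWithinAt z
      (differentiableWithinAt_id.prodMk (hd z hz))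
  have hfd := @hcomp f fun x hx => (hb x hx).1.2.1
  have hgd := @hcomp g fun x hx => (hb x hx).1.2.2
  obtain ⟨u, hud, hum, hfix⟩ := exists_fixedPoint_of_holomorphic_contraction
    (U := ball (0 : ℂ) r) isOpen_ball (c := (s, t)) (half_pos hρ).le
    (fun u z => (s + J m (fun z => f (z, u z)) z, t + J n (fun z => g (z, u z)) z))
    (by
      intro u hd hu
      obtain ⟨d1, z1, e1⟩ := hJ m _ (hfd hd hu)
      obtain ⟨d2, z2, e2⟩ := hJ n _ (hgd hd hu)
      refine ⟨(d1.const_add s).prodMk (d2.const_add t), fun z hz => ?_⟩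
      have hbd := fun ζ (hζ : ζ ∈ ball (0 : ℂ) r) => norm_prod_le_iff.1 (hb _ (hball hu hζ)).2.le
      have b1 := norm_le_of_hasDerivAt_pow_mul z1 e1 (fun ζ hζ => (hbd ζ hζ).1) hz
      have b2 := norm_le_of_hasDerivAt_pow_mul z2 e2 (fun ζ hζ => (hbd ζ hζ).2) hz
      have hzr : M * ‖z‖ ≤ ρ / 2 := by
        rw [mem_ball_zero_iff] at hz
        exact (by gcongr : M * ‖z‖ ≤ M * r).trans hrM
      rw [mem_closedBall, Prod.dist_eq]
      simpa [dist_eq_norm] using ⟨b1.trans hzr, b2.trans hzr⟩)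
    (by
      intro u v hdu hu hdv hv C hC z hz
      obtain ⟨-, z1, e1⟩ := hJ m _ (hfd hdu hu)
      obtain ⟨-, z2, e2⟩ := hJ n _ (hgd hdu hu)
      obtain ⟨-, z1', e1'⟩ := hJ m _ (hfd hdv hv)
      obtain ⟨-, z2', e2'⟩ := hJ n _ (hgd hdv hv)
      have hbd := fun ζ (hζ : ζ ∈ ball (0 : ℂ) r) => by
        have h := hL.dist_le_mul _ (hb _ (hball hu hζ)).1.1 _ (hb _ (hball hv hζ)).1.1
        rw [hdist, dist_eq_norm] at h
        exact norm_prod_le_iff.1 (h.trans (mul_le_mul_of_nonneg_left (hC ζ hζ) L.2))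
      have hC0 : 0 ≤ C := dist_nonneg.trans (hC z hz)
      have hzr : L * C * ‖z‖ ≤ C / 2 := by
        rw [mem_ball_zero_iff] at hz
        calc L * C * ‖z‖ ≤ L * C * r := by gcongr
          _ = C * (L * r) := by ring
          _ ≤ C * (1 / 2) := by gcongr
          _ = C / 2 := by ring
      have b1 := norm_le_of_hasDerivAt_pow_mul (m := m)
        (w := fun z => J m (fun z => f (z, u z)) z - J m (fun z => f (z, v z)) z)
        (g := fun z => f (z, u z) - f (z, v z)) (by simp [z1, z1'])
        (fun ζ hζ => by simpa only [mul_sub] using (e1 ζ hζ).fun_sub (e1' ζ hζ))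
        (fun ζ hζ => (hbd ζ hζ).1) hz
      have b2 := norm_le_of_hasDerivAt_pow_mul (m := n)
        (w := fun z => J n (fun z => g (z, u z)) z - J n (fun z => g (z, v z)) z)
        (g := fun z => g (z, u z) - g (z, v z)) (by simp [z2, z2'])
        (fun ζ hζ => by simpa only [mul_sub] using (e2 ζ hζ).fun_sub (e2' ζ hζ))
        (fun ζ hζ => (hbd ζ hζ).2) hz
      rw [Prod.dist_eq]
      simpa [dist_eq_norm] using ⟨b1.trans hzr, b2.trans hzr⟩)
  have h0 : ball (0 : ℂ) r ∈ 𝓝 0 := ball_mem_nhds 0 hr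
  obtain ⟨-, z1, e1⟩ := hJ m _ (hfd hud hum)
  obtain ⟨-, z2, e2⟩ := hJ n _ (hgd hud hum)
  have hX : ∀ z ∈ ball (0 : ℂ) r, (u z).1 - s = J m (fun z => f (z, u z)) z := fun z hz => by
    rw [← hfix z hz]; simp
  have hY : ∀ z ∈ ball (0 : ℂ) r, (u z).2 - t = J n (fun z => g (z, u z)) z := fun z hz => by
    rw [← hfix z hz]; simp
  refine ⟨fun z => (u z).1, fun z => (u z).2, hud.fst.analyticAt h0, hud.snd.analyticAt h0,
    sub_eq_zero.1 ((hX 0 (mem_ball_self hr)).trans z1),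
    sub_eq_zero.1 ((hY 0 (mem_ball_self hr)).trans z2), ?_⟩
  filter_upwards [h0] with z hz
  have hzn := isOpen_ball.mem_nhds hz
  exact ⟨(e1 z hz).congr_of_eventuallyEq (by filter_upwards [hzn] with ζ hζ; rw [hX ζ hζ]),
    (e2 z hz).congr_of_eventuallyEq (by filter_upwards [hzn] with ζ hζ; rw [hY ζ hζ])⟩

/-- The Riccati solution `z / ((1 - z) log (1 - z))` extends holomorphically to `z = 0`. -/
theorem exists_analyticAt_div_log :
    ∃ P : ℂ → ℂ, AnalyticAt ℂ P 0 ∧ P 0 = -1 ∧ ∀ᶠ z in 𝓝 0, z ≠ 0 →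
      P z = z / ((1 - z) * Complex.log (1 - z)) ∧
      z * (z - 1) * deriv P z = -(1 - z) * P z ^ 2 - P z := by
  have hlog : ∀ {z : ℂ}, 1 - z ∈ Complex.slitPlane →
      HasDerivAt (fun z : ℂ => Complex.log (1 - z)) (-1 / (1 - z)) z := fun hz =>
    ((hasDerivAt_id _).const_sub 1).clog hz
  have hslit : ∀ᶠ z : ℂ in 𝓝 0, 1 - z ∈ Complex.slitPlane :=
    ContinuousAt.eventually_mem (by fun_prop)
      (Complex.isOpen_slitPlane.mem_nhds (by simp))
  set D := dslope (fun z : ℂ => Complex.log (1 - z)) 0 with hD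
  have hD0 : D 0 = -1 := by
    rw [hD, dslope_same, (hlog (by simp)).deriv]; simp
  have hDan : AnalyticAt ℂ D 0 := by
    have hd : DifferentiableOn ℂ D {z : ℂ | 1 - z ∈ Complex.slitPlane} :=
      (Complex.differentiableOn_dslope hslit).2 fun z hz =>
        (hlog hz).differentiableAt.differentiableWithinAt
    exact hd.analyticAt hslit
  have hne : ∀ᶠ z in 𝓝 0, D z ≠ 0 := hDan.continuousAt.eventually_ne (by simp [hD0])
  have hDz : ∀ z : ℂ, z ≠ 0 → D z = Complex.log (1 - z) / z := fun z hz => by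
    rw [hD, dslope_of_ne _ hz, slope_def_field]; simp
  refine ⟨fun z => 1 / ((1 - z) * D z), ?_, by simp [hD0], ?_⟩
  · exact analyticAt_const.div ((analyticAt_const.sub analyticAt_id).mul hDan) (by simp [hD0])
  filter_upwards [hslit, hne] with z hz hDne hz0
  have h1 : 1 - z ≠ 0 := Complex.slitPlane_ne_zero hz
  have hl : Complex.log (1 - z) ≠ 0 := fun h => hDne (by rw [hDz z hz0, h, zero_div])
  have hval : ∀ z : ℂ, z ≠ 0 → 1 / ((1 - z) * D z) = z / ((1 - z) * Complex.log (1 - z)) :=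
    fun z hz => by rw [hDz z hz, ← mul_div_assoc, one_div_div]
  refine ⟨hval z hz0, ?_⟩
  have hder := (hasDerivAt_id z).fun_div
    ((((hasDerivAt_id z).const_sub 1).fun_mul (hlog hz))) (mul_ne_zero h1 hl)
  have heq : (fun z => 1 / ((1 - z) * D z)) =ᶠ[𝓝 z]
      fun z => id z / ((1 - id z) * Complex.log (1 - z)) := by
    filter_upwards [eventually_ne_nhds hz0] with ζ hζ using hval ζ hζ
  rw [heq.deriv_eq, hder.deriv, hval z hz0]
  simp only [id]
  field_simp
  ring

/-- The substitution `q = 1 + z X`, `p = -1 + z W` with `W = R + X + K`, where `-1 + z R` is the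
Riccati solution at `q = 1`, turns the system into one for `(X, K)`; this is `X'`. -/
noncomputable def fieldX (z X W : ℂ) : ℂ :=
  X * ((2 * W * (1 - z + z * X) + 2 - 2 * X) * (1 + z * X) - X - 1) / (z - 1)

/-- The right-hand side `c` of the equation `z K' + 2 K = z c`. -/
noncomputable def fieldK (z X K R : ℂ) : ℂ :=
  let H := X + K
  let W := R + H
  2 * R * H + H ^ 2
    + (-2 * X + 3 * X ^ 2 + (4 * X - 2 * z * X + 3 * z * X ^ 2) * (-2 * W + z * W ^ 2) + 2 * X * W)
    + (H + (4 * X - 2 * z * X + 3 * z * X ^ 2) * (-1 + z * W) ^ 2 + 2 * X * (-1 + z * W)) / (1 - z)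
    - fieldX z X W

end


/-- On the stratum `D₄` (i.e. `κ₀ = κ₁ = κ₂ = κ₃ = 0`, `κ₄ = 1`), Painlevé VI admits a
`1`-parameter family of solution germs at `z = 0` with `q(0) = 1`, `q′(0) = t` and
`p(z) = z/((1−z)·log(1−z)) + h(z)` where `h` is analytic with `h(0) = 0`, `h′(0) = t`.
Here `log` is the principal branch `Complex.log`. -/
theorem holomorphic_solution_family_D4
    (κ₀ κ₁ κ₂ κ₃ κ₄ : ℂ) (h₀ : κ₀ = 0) (h₁ : κ₁ = 0) (h₂ : κ₂ = 0)
    (h₃ : κ₃ = 0) (h₄ : κ₄ = 1) (t : ℂ) :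
    ∃ (r : ℝ) (q p h : ℂ → ℂ), 0 < r ∧ r < 1 ∧
      (∀ z ∈ Metric.ball (0 : ℂ) r, AnalyticAt ℂ q z) ∧
      q 0 = 1 ∧ deriv q 0 = t ∧
      (∀ z ∈ Metric.ball (0 : ℂ) r, AnalyticAt ℂ h z) ∧
      h 0 = 0 ∧ deriv h 0 = t ∧
      (∀ z ∈ Metric.ball (0 : ℂ) r, z ≠ 0 →
        p z = z / ((1 - z) * Complex.log (1 - z)) + h z) ∧
      ∀ z ∈ Metric.ball (0 : ℂ) r, z ≠ 0 → SolvesPVIAt κ₀ κ₁ κ₂ κ₃ κ₄ q p z := by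
  subst h₀ h₁ h₂ h₃ h₄
  obtain ⟨P, hPan, hP0, hP⟩ := exists_analyticAt_div_log
  have hRan : AnalyticAt ℂ (dslope P 0) 0 := by
    obtain ⟨s, hs, hd⟩ := hPan.eventually_analyticAt.exists_mem
    exact ((Complex.differentiableOn_dslope hs).2 fun z hz =>
      (hd z hz).differentiableAt.differentiableWithinAt).analyticAt hs
  have hR : ∀ z, P z = -1 + z * dslope P 0 z := fun z => by
    have := sub_smul_dslope P 0 z
    rw [smul_eq_mul, hP0] at this
    linear_combination -this
  set R := dslope P 0
  have hR' : AnalyticAt ℂ (fun x : ℂ × ℂ × ℂ => R x.1) (0, t, 0) :=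
    AnalyticAt.comp_of_eq hRan analyticAt_fst rfl
  have hz : AnalyticAt ℂ (fun x : ℂ × ℂ × ℂ => x.1) (0, t, 0) := analyticAt_fst
  have hX : AnalyticAt ℂ (fun x : ℂ × ℂ × ℂ => x.2.1) (0, t, 0) :=
    analyticAt_fst.comp analyticAt_snd
  have hK : AnalyticAt ℂ (fun x : ℂ × ℂ × ℂ => x.2.2) (0, t, 0) :=
    analyticAt_snd.comp analyticAt_snd
  have hf : AnalyticAt ℂ (fun x : ℂ × ℂ × ℂ => fieldX x.1 x.2.1 (R x.1 + (x.2.1 + x.2.2)))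
      (0, t, 0) := by
    unfold fieldX
    exact AnalyticAt.div (by fun_prop) (by fun_prop) (by simp)
  have hg : AnalyticAt ℂ (fun x : ℂ × ℂ × ℂ => fieldK x.1 x.2.1 x.2.2 (R x.1)) (0, t, 0) := by
    unfold fieldK
    refine AnalyticAt.fun_sub (AnalyticAt.fun_add (by fun_prop) ?_) hf
    exact AnalyticAt.fun_div (by fun_prop) (by fun_prop) (by simp)
  obtain ⟨X, K, hXan, hKan, hX0, hK0, hXK⟩ := exists_briotBouquet_solution 0 2 t 0 hf hg
  obtain ⟨s, hs, hev⟩ := Metric.eventually_nhds_iff_ball.1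
    (hP.and (hPan.eventually_analyticAt.and
      (hXan.eventually_analyticAt.and (hKan.eventually_analyticAt.and hXK))))
  have hder : ∀ {u : ℂ → ℂ} {z : ℂ}, AnalyticAt ℂ u z →
      HasDerivAt (fun z => z * u z) (u z + z * deriv u z) z := fun hu => by
    simpa using (hasDerivAt_id _).fun_mul hu.differentiableAt.hasDerivAt
  have hball : ∀ z ∈ Metric.ball (0 : ℂ) (min s (1 / 2)), z ∈ Metric.ball (0 : ℂ) s :=
    fun z hz => Metric.ball_subset_ball (min_le_left _ _) hz
  refine ⟨min s (1 / 2), fun z => 1 + z * X z, fun z => P z + z * (X z + K z),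
    fun z => z * (X z + K z), by positivity, (min_le_right _ _).trans_lt (by norm_num),
    fun z hz => ?_, by simp, ?_, fun z hz => ?_, by simp, ?_, fun z hz hz0 => ?_,
    fun z hz hz0 => ?_⟩
  · have := (hev z (hball z hz)).2.2.1
    fun_prop
  · rw [((hder hXan).const_add 1).deriv, hX0]; simp
  · obtain ⟨-, -, h1, h2, -⟩ := hev z (hball z hz)
    fun_prop
  · rw [(hder (hXan.fun_add hKan)).deriv, hX0, hK0]; simp
  · simp only [((hev z (hball z hz)).1 hz0).1]
  obtain ⟨hPz, hPa, hXa, hKa, hXd, hKd⟩ := hev z (hball z hz)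
  have hz1 : 1 - z ≠ 0 := by
    intro h
    rw [← sub_eq_zero.1 h] at hz
    simp at hz
    linarith [hz.2]
  have hz1' : z - 1 ≠ 0 := fun h => hz1 (by linear_combination -h)
  have eX : deriv X z = fieldX z (X z) (R z + (X z + K z)) := by
    simpa [deriv_sub_const] using hXd.deriv
  have eK : z * deriv K z + 2 * K z = z * fieldK z (X z) (K z) (R z) := by
    have h := ((hasDerivAt_pow 2 z).fun_mul hKa.differentiableAt.hasDerivAt).unique
      (by simpa using hKd)
    refine mul_left_cancel₀ hz0 ?_
    simp only [Nat.cast_ofNat] at h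
    linear_combination h
  have eP := (hPz hz0).2
  have dq := ((hder hXa).const_add 1).deriv
  have dp := (hPa.differentiableAt.hasDerivAt.fun_add (hder (hXa.fun_add hKa))).deriv
  rw [deriv_fun_add hXa.differentiableAt hKa.differentiableAt] at dp
  have eX' : (z - 1) * deriv X z = X z * ((2 * (R z + (X z + K z)) * (1 - z + z * X z) + 2
      - 2 * X z) * (1 + z * X z) - X z - 1) := by
    rw [eX, fieldX, mul_div_cancel₀ _ hz1']
  have eK' : (1 - z) * (z * deriv K z + 2 * K z + z * deriv X z) = z * ((1 - z) *
      (fieldK z (X z) (K z) (R z) + fieldX z (X z) (R z + (X z + K z)))) := by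
    rw [eK, eX]; ring
  rw [fieldK, sub_add_cancel, mul_add (1 - z) _ (_ / _), mul_div_cancel₀ _ hz1] at eK'
  refine ⟨?_, ?_⟩
  · simp only [dq, hR z]
    linear_combination z ^ 2 * eX'
  · rw [dp]
    rw [hR z] at eP
    simp only [hR z]
    linear_combination eP - z * eK'
end
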